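/- arXiv:0810.1401 — 4 statements merged into one kernel-verified Lean document; each statement's English description precedes it below -/
import Mathlib

section
/- Let A be a hereditary ring and (𝒳, 𝒴) an Ext-orthogonal pair for Mod A. Then the following are equivalent: (1) 𝒴 is closed under arbitrary coproducts (direct sums); (2) every module in 𝒳 is a filtered colimit of finitely presented modules belonging to 𝒳, i.e. for every M ∈ 𝒳 there are a small filtered category J and a functor F : J → Mod A with each F(j) finitely presented and in 𝒳, such that M ≅ colim F; (3) there exists a class 𝒞 of finitely presented A-modules with 𝒞^⊥ = 𝒴. -/
open CategoryTheory CategoryTheory.Limits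

universe u

/-- A ring is (left) hereditary if every submodule of a projective module is projective. -/
def IsHereditaryRing (A : Type u) [Ring A] : Prop :=
  ∀ (M : Type u) [AddCommGroup M] [Module A M], Module.Projective A M →
    ∀ (N : Submodule A M), Module.Projective A N

namespace ExtOrth

section abelian
universe w v u'
variable {C : Type u'} [Category.{v} C] [Abelian C] [HasExt.{w} C]

/-- All Ext groups vanish. -/
def Orth (X Y : C) : Prop := ∀ n : ℕ, Subsingleton (Abelian.Ext X Y n)

open Abelian

lemma ext_zero_subsingleton_iff (X Y : C) :
    Subsingleton (Ext X Y 0) ↔ ∀ f : X ⟶ Y, f = 0 := by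
  constructor
  · intro h f
    exact (Ext.mk₀_bijective X Y).1 (Subsingleton.elim _ _)
  · intro h
    refine ⟨fun a b => ?_⟩
    obtain ⟨f, rfl⟩ := (Ext.mk₀_bijective X Y).2 a
    obtain ⟨g, rfl⟩ := (Ext.mk₀_bijective X Y).2 b
    rw [h f, h g]

lemma subsingleton_of_zero {X Y : C} {n : ℕ} (h : ∀ e : Ext X Y n, e = 0) :
    Subsingleton (Ext X Y n) := ⟨fun a b => by rw [h a, h b]⟩

lemma orth_iff_proj {S : ShortComplex C} (hS : S.ShortExact) [Projective S.X₁] [Projective S.X₂]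
    (Y : C) : Orth S.X₃ Y ↔ Function.Bijective (fun f : S.X₂ ⟶ Y => S.f ≫ f) := by
  have := hS.epi_g
  have hpd : HasProjectiveDimensionLT S.X₃ 2 :=
    hS.hasProjectiveDimensionLT_X₃ 1 inferInstance inferInstance
  constructor
  · intro h
    constructor
    · intro f g hfg
      have h0 : S.f ≫ (f - g) = 0 := by
        rw [Preadditive.comp_sub, sub_eq_zero]; exact hfg
      obtain ⟨k, hk⟩ := CokernelCofork.IsColimit.desc' hS.gIsCokernel (f - g) h0
      have : k = 0 := (ext_zero_subsingleton_iff _ _).1 (h 0) k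
      rw [← sub_eq_zero, ← hk, this, comp_zero]
    · intro g
      obtain ⟨x, hx⟩ := Ext.contravariant_sequence_exact₁ hS Y (Ext.mk₀ g) (n₁ := 1) rfl
        (@Subsingleton.elim _ (h 1) _ _)
      obtain ⟨f, rfl⟩ := (Ext.mk₀_bijective _ _).2 x
      refine ⟨f, ?_⟩
      rw [Ext.mk₀_comp_mk₀] at hx
      exact (Ext.mk₀_bijective _ _).1 hx
  · rintro ⟨hi, hs⟩ n
    rcases n with _ | _ | n
    · rw [ext_zero_subsingleton_iff]
      intro f
      rw [← cancel_epi S.g, comp_zero]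
      apply hi
      simp
    · apply subsingleton_of_zero
      intro e
      obtain ⟨x, rfl⟩ := Ext.contravariant_sequence_exact₃ hS Y e
        (Ext.eq_zero_of_projective _) (n₀ := 0) rfl
      obtain ⟨g, rfl⟩ := (Ext.mk₀_bijective _ _).2 x
      obtain ⟨f, rfl⟩ := hs g
      dsimp only
      rw [← Ext.mk₀_comp_mk₀, ShortComplex.ShortExact.extClass_comp_assoc]
    · exact HasProjectiveDimensionLT.subsingleton S.X₃ 2 _ (by omega) Y

lemma orth_iff_inj {S : ShortComplex C} (hS : S.ShortExact) [Injective S.X₂]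
    (X : C) [HasProjectiveDimensionLT X 2] :
    Orth X S.X₁ ↔ Function.Bijective (fun f : X ⟶ S.X₂ => f ≫ S.g) := by
  have := hS.mono_f
  constructor
  · intro h
    constructor
    · intro f g hfg
      have h0 : (f - g) ≫ S.g = 0 := by
        rw [Preadditive.sub_comp, sub_eq_zero]; exact hfg
      obtain ⟨k, hk⟩ := KernelFork.IsLimit.lift' hS.fIsKernel (f - g) h0
      have : k = 0 := (ext_zero_subsingleton_iff _ _).1 (h 0) k
      rw [← sub_eq_zero, ← hk, this, zero_comp]
    · intro g
      obtain ⟨x, hx⟩ := Ext.covariant_sequence_exact₃ X hS (Ext.mk₀ g) (n₁ := 1) rfl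
        (@Subsingleton.elim _ (h 1) _ _)
      obtain ⟨f, rfl⟩ := (Ext.mk₀_bijective _ _).2 x
      refine ⟨f, ?_⟩
      rw [Ext.mk₀_comp_mk₀] at hx
      exact (Ext.mk₀_bijective _ _).1 hx
  · rintro ⟨hi, hs⟩ n
    rcases n with _ | _ | n
    · rw [ext_zero_subsingleton_iff]
      intro f
      rw [← cancel_mono S.f, zero_comp]
      apply hi
      simp
    · apply subsingleton_of_zero
      intro e
      obtain ⟨x, rfl⟩ := Ext.covariant_sequence_exact₁ X hS e
        (Ext.eq_zero_of_injective _) (n₀ := 0) rfl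
      obtain ⟨g, rfl⟩ := (Ext.mk₀_bijective _ _).2 x
      obtain ⟨f, rfl⟩ := hs g
      dsimp only
      rw [← Ext.mk₀_comp_mk₀, Ext.comp_assoc_of_second_deg_zero,
        ShortComplex.ShortExact.comp_extClass, Ext.comp_zero]
    · exact HasProjectiveDimensionLT.subsingleton X 2 _ (by omega) _

end abelian

section modules
variable {A : Type u} [Ring A]

/-- restriction along `i` is bijective on maps to `Y`. -/
def Res {P Q : Type u} [AddCommGroup P] [Module A P] [AddCommGroup Q] [Module A Q]
    (i : P →ₗ[A] Q) (Y : Type u) [AddCommGroup Y] [Module A Y] : Prop :=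
  (∀ f : Q →ₗ[A] Y, (∀ x, f (i x) = 0) → ∀ x, f x = 0) ∧
  (∀ g : P →ₗ[A] Y, ∃ f : Q →ₗ[A] Y, ∀ x, f (i x) = g x)

/-- The short exact sequence attached to a surjection. -/
def kerSES {Q X : Type u} [AddCommGroup Q] [Module A Q] [AddCommGroup X] [Module A X]
    (q : Q →ₗ[A] X) : ShortComplex (ModuleCat.{u} A) :=
  ShortComplex.mk (ModuleCat.ofHom (LinearMap.ker q).subtype) (ModuleCat.ofHom q)
    (by ext x; exact x.2)

lemma kerSES_exact {Q X : Type u} [AddCommGroup Q] [Module A Q] [AddCommGroup X] [Module A X]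
    (q : Q →ₗ[A] X) (hq : Function.Surjective q) : (kerSES q).ShortExact where
  exact := by
    rw [ShortComplex.moduleCat_exact_iff]
    intro x hx
    exact ⟨⟨x, hx⟩, rfl⟩
  mono_f := by
    rw [ModuleCat.mono_iff_injective]
    exact Subtype.val_injective
  epi_g := by
    rw [ModuleCat.epi_iff_surjective]
    exact hq

lemma orth_iff_res [HasExt.{u} (ModuleCat.{u} A)] (hA : IsHereditaryRing A) {Q : Type u} [AddCommGroup Q] [Module A Q]
    [hQ : Module.Projective A Q] {X : Type u} [AddCommGroup X] [Module A X]
    (q : Q →ₗ[A] X) (hq : Function.Surjective q) (Y : Type u) [AddCommGroup Y] [Module A Y] :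
    Orth (ModuleCat.of A X) (ModuleCat.of A Y) ↔ Res (LinearMap.ker q).subtype Y := by
  have h1 : Module.Projective A (LinearMap.ker q) := hA Q hQ _
  have : Projective (kerSES q).X₁ := (IsProjective.iff_projective _).1 h1
  have : Projective (kerSES q).X₂ := (IsProjective.iff_projective _).1 hQ
  refine (orth_iff_proj (kerSES_exact q hq) (ModuleCat.of A Y)).trans ?_
  constructor
  · rintro ⟨hi, hs⟩
    constructor
    · intro f hf x
      have : ModuleCat.ofHom f = 0 := hi (by ext x; exact hf x)
      exact congrArg (fun k : (ModuleCat.of A Q ⟶ ModuleCat.of A Y) => k.hom x) this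
    · intro g
      obtain ⟨f, hf⟩ := hs (ModuleCat.ofHom g)
      exact ⟨f.hom, fun x => congrArg
        (fun k : (ModuleCat.of A (LinearMap.ker q) ⟶ ModuleCat.of A Y) => k.hom x) hf⟩
  · rintro ⟨hi, hs⟩
    constructor
    · intro f g hfg
      ext x
      have := hi (f.hom - g.hom) (fun x => by
        have := congrArg
          (fun k : (ModuleCat.of A (LinearMap.ker q) ⟶ ModuleCat.of A Y) => k.hom x) hfg
        exact sub_eq_zero.2 this) x
      exact sub_eq_zero.1 this
    · intro g
      obtain ⟨f, hf⟩ := hs g.hom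
      exact ⟨ModuleCat.ofHom f, by ext x; exact hf x⟩

lemma pd_lt_two (hA : IsHereditaryRing A) (X : ModuleCat.{u} A) :
    HasProjectiveDimensionLT X 2 := by
  let q : (X →₀ A) →ₗ[A] X := Finsupp.linearCombination A id
  have hq : Function.Surjective q := Finsupp.linearCombination_id_surjective A X
  have hQ : Module.Projective A (X →₀ A) := inferInstance
  have h1 : Module.Projective A (LinearMap.ker q) := hA _ hQ _
  have : Projective (kerSES q).X₁ := (IsProjective.iff_projective _).1 h1
  have : Projective (kerSES q).X₂ := (IsProjective.iff_projective _).1 hQ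
  exact (kerSES_exact q hq).hasProjectiveDimensionLT_X₃ 1 inferInstance inferInstance

/-- The left orthogonal is closed under colimits. -/
lemma orth_colimit [HasExt.{u} (ModuleCat.{u} A)] (hA : IsHereditaryRing A) {J : Type u} [SmallCategory J]
    (F : J ⥤ ModuleCat.{u} A) (X Y : ModuleCat.{u} A) (e : X ≅ colimit F)
    (h : ∀ j, Orth (F.obj j) Y) : Orth X Y := by
  let i := Injective.ι Y
  let S : ShortComplex (ModuleCat.{u} A) := ShortComplex.mk i (cokernel.π i) (by simp)
  have hS : S.ShortExact := ShortComplex.ShortExact.mk'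
    (ShortComplex.exact_of_g_is_cokernel _ (cokernelIsCokernel i)) (inferInstanceAs (Mono i))
    (inferInstanceAs (Epi (cokernel.π i)))
  have : Injective S.X₂ := inferInstanceAs (Injective (Injective.under Y))
  have hp := pd_lt_two hA
  have hb : ∀ j, Function.Bijective (fun f : F.obj j ⟶ S.X₂ => f ≫ S.g) :=
    fun j => (orth_iff_inj hS _).1 (h j)
  refine (orth_iff_inj hS X).2 ⟨?_, ?_⟩
  · intro f g hfg
    rw [← cancel_epi e.inv]
    apply colimit.hom_ext
    intro j
    apply (hb j).1
    simpa using congrArg (fun k => colimit.ι F j ≫ e.inv ≫ k) hfg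
  · intro g
    choose s hs using fun j => (hb j).2 (colimit.ι F j ≫ e.inv ≫ g)
    dsimp only at hs
    have hnat : ∀ ⦃j k : J⦄ (f : j ⟶ k), F.map f ≫ s k = s j := by
      intro j k f
      apply (hb j).1
      simp [hs]
    let c : Cocone F := Cocone.mk S.X₂ (NatTrans.mk s (fun j k f => by
      simp [hnat]))
    refine ⟨e.hom ≫ colimit.desc F c, ?_⟩
    dsimp only
    rw [← cancel_epi e.inv]
    apply colimit.hom_ext
    intro j
    simp [hs, c]


lemma ker_retract (hA : IsHereditaryRing A) {P F : Type u} [AddCommGroup P] [Module A P]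
    [AddCommGroup F] [Module A F] (hF : Module.Projective A F) (κ : P →ₗ[A] F) :
    ∃ ρ : P →ₗ[A] LinearMap.ker κ, ∀ x : LinearMap.ker κ, ρ x = x := by
  have : Module.Projective A (LinearMap.range κ) := hA F hF _
  obtain ⟨s, hs⟩ := Module.projective_lifting_property κ.rangeRestrict LinearMap.id
    κ.surjective_rangeRestrict
  have hs' : ∀ y, κ (s y) = y := fun y =>
    congrArg Subtype.val (LinearMap.congr_fun hs y)
  refine ⟨LinearMap.codRestrict _ (LinearMap.id - s ∘ₗ κ.rangeRestrict) ?_, ?_⟩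
  · intro x
    simp [hs']
  · intro x
    ext
    have : κ.rangeRestrict x = 0 := by
      ext; exact x.2
    simp [this]

/-- Every finitely generated submodule of a projective module is contained in a finitely generated
direct summand. -/
lemma exists_summand (hA : IsHereditaryRing A) {P : Type u} [AddCommGroup P] [Module A P]
    [hP : Module.Projective A P] (S : Submodule A P) (hS : S.FG) :
    ∃ D : Submodule A P, S ≤ D ∧ D.FG ∧ ∃ ρ : P →ₗ[A] D, ∀ x : D, ρ x = x := by
  classical
  obtain ⟨s, hs⟩ := hP.out
  obtain ⟨T, rfl⟩ := hS
  let U : Finset P := T.biUnion (fun t => (s t).support)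
  let κ : P →ₗ[A] ({x : P // x ∉ U} →₀ A) := Finsupp.lcomapDomain Subtype.val
    Subtype.val_injective ∘ₗ s
  have hκ : ∀ x, κ x = 0 ↔ s x ∈ Finsupp.supported A A (U : Set P) := by
    intro x
    rw [Finsupp.mem_supported', Finsupp.ext_iff]
    constructor
    · intro h y hy
      exact h ⟨y, hy⟩
    · intro h y
      exact h y.1 y.2
  obtain ⟨ρ, hρ⟩ := ker_retract hA inferInstance κ
  refine ⟨LinearMap.ker κ, ?_, ?_, ρ, hρ⟩
  · rw [Submodule.span_le]
    intro t ht
    rw [SetLike.mem_coe, LinearMap.mem_ker, hκ, Finsupp.mem_supported]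
    intro y hy
    exact Finset.mem_biUnion.2 ⟨t, ht, hy⟩
  · let r : (P →₀ A) →ₗ[A] P := Finsupp.linearCombination A id
    have hfg : (Finsupp.supported A A (U : Set P)).FG := by
      rw [Finsupp.supported_eq_span_single]
      exact Submodule.fg_span (Set.Finite.image _ U.finite_toSet)
    have : LinearMap.ker κ =
        (Finsupp.supported A A (U : Set P)).map ((LinearMap.ker κ).subtype ∘ₗ ρ ∘ₗ r) := by
      apply le_antisymm
      · intro x hx
        refine ⟨s x, (hκ x).1 hx, ?_⟩
        have h1 : r (s x) = x := hs x
        simp only [LinearMap.comp_apply, h1]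
        exact congrArg Subtype.val (hρ ⟨x, hx⟩)
      · rintro _ ⟨y, -, rfl⟩
        exact (ρ (r y)).2
    rw [this]
    exact hfg.map _

lemma split_pair (hA : IsHereditaryRing A) {U F Y : Type u} [AddCommGroup U] [Module A U]
    [AddCommGroup F] [Module A F] [AddCommGroup Y] [Module A Y] (hF : Module.Projective A F)
    (l : U →ₗ[A] F) (G : Submodule A F) (g : (G.comap l) →ₗ[A] Y) :
    ∃ (a : U →ₗ[A] Y) (b : G →ₗ[A] Y), ∀ (x : U) (h : l x ∈ G), a x + b ⟨l x, h⟩ = g ⟨x, h⟩ := by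
  let κ : (U × G) →ₗ[A] F := l.coprod G.subtype
  obtain ⟨ρ, hρ⟩ := ker_retract hA hF κ
  let t : LinearMap.ker κ →ₗ[A] G.comap l :=
    LinearMap.codRestrict _ (LinearMap.fst A U G ∘ₗ (LinearMap.ker κ).subtype) (by
      rintro ⟨⟨x, y⟩, hxy⟩
      have h : l x + y = 0 := hxy
      have : l x = -y := by rw [eq_neg_iff_add_eq_zero]; exact h
      change l x ∈ G
      rw [this]
      exact G.neg_mem y.2)
  refine ⟨g ∘ₗ t ∘ₗ ρ ∘ₗ LinearMap.inl A U G, -(g ∘ₗ t ∘ₗ ρ ∘ₗ LinearMap.inr A U G), ?_⟩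
  intro x h
  have hk : (x, -(⟨l x, h⟩ : G)) ∈ LinearMap.ker κ := by
    simp [κ]
  have h1 : (x, -(⟨l x, h⟩ : G)) = LinearMap.inl A U G x - LinearMap.inr A U G ⟨l x, h⟩ := by
    simp
  have h2 := hρ ⟨_, hk⟩
  simp only at h2
  have h3 : ρ (LinearMap.inl A U G x) - ρ (LinearMap.inr A U G ⟨l x, h⟩) = ⟨_, hk⟩ := by
    rw [← map_sub, ← h1, h2]
  simp only [LinearMap.comp_apply, LinearMap.neg_apply]
  rw [← sub_eq_add_neg, ← map_sub, ← map_sub, h3]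
  rfl

lemma res_pi {P Q : Type u} [AddCommGroup P] [Module A P] [AddCommGroup Q] [Module A Q]
    (i : P →ₗ[A] Q) {ι : Type u} (Y : ι → Type u) [∀ k, AddCommGroup (Y k)]
    [∀ k, Module A (Y k)] (h : ∀ k, Res i (Y k)) : Res i (∀ k, Y k) := by
  constructor
  · intro f hf x
    funext k
    exact (h k).1 (LinearMap.proj k ∘ₗ f) (fun x => congrFun (hf x) k) x
  · intro g
    choose f hf using fun k => (h k).2 (LinearMap.proj k ∘ₗ g)
    exact ⟨LinearMap.pi f, fun x => funext fun k => hf k x⟩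

lemma res_ext {P Q : Type u} [AddCommGroup P] [Module A P] [AddCommGroup Q] [Module A Q]
    [Module.Projective A Q]
    (i : P →ₗ[A] Q) {Y Y' Z : Type u} [AddCommGroup Y] [Module A Y] [AddCommGroup Y'] [Module A Y']
    [AddCommGroup Z] [Module A Z] (j : Y →ₗ[A] Y') (p : Y' →ₗ[A] Z) (hj : Function.Injective j)
    (hp : Function.Surjective p) (hjp : ∀ y, p y = 0 ↔ ∃ x, j x = y)
    (hY : Res i Y) (hZ : Res i Z) : Res i Y' := by
  have fac : ∀ {W : Type u} [AddCommGroup W] [Module A W] (f : W →ₗ[A] Y'),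
      (∀ x, p (f x) = 0) → ∃ g : W →ₗ[A] Y, ∀ x, j (g x) = f x := by
    intro W _ _ f hf
    let e := LinearEquiv.ofInjective j hj
    refine ⟨e.symm.toLinearMap ∘ₗ LinearMap.codRestrict (LinearMap.range j) f
      (fun x => (hjp _).1 (hf x)), fun x => ?_⟩
    have := e.apply_symm_apply (LinearMap.codRestrict (LinearMap.range j) f
      (fun x => (hjp _).1 (hf x)) x)
    exact congrArg Subtype.val this
  constructor
  · intro f hf x
    obtain ⟨g, hg⟩ := fac f (hZ.1 (p ∘ₗ f) (fun x => by simp [hf]))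
    rw [← hg, hY.1 g (fun x => hj (by rw [hg, hf, map_zero])) x, map_zero]
  · intro g
    obtain ⟨f0, hf0⟩ := hZ.2 (p ∘ₗ g)
    obtain ⟨f1, hf1⟩ := Module.projective_lifting_property p f0 hp
    have hf1' : ∀ x, p (f1 x) = f0 x := fun x => LinearMap.congr_fun hf1 x
    obtain ⟨k, hk⟩ := fac (g - f1 ∘ₗ i) (fun x => by simp [hf1', hf0])
    obtain ⟨k', hk'⟩ := hY.2 k
    refine ⟨f1 + j ∘ₗ k', fun x => ?_⟩
    simp [hk', hk]

lemma res_coker {P Q : Type u} [AddCommGroup P] [Module A P] [AddCommGroup Q] [Module A Q]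
    [Module.Projective A Q] [Module.Projective A P]
    (i : P →ₗ[A] Q) {Y Y' Z : Type u} [AddCommGroup Y] [Module A Y] [AddCommGroup Y'] [Module A Y']
    [AddCommGroup Z] [Module A Z] (j : Y →ₗ[A] Y') (p : Y' →ₗ[A] Z)
    (hp : Function.Surjective p) (hjp : ∀ y, p y = 0 ↔ ∃ x, j x = y)
    (hY : Res i Y) (hY' : Res i Y') : Res i Z := by
  constructor
  · intro h hh x
    obtain ⟨f, hf⟩ := Module.projective_lifting_property p h hp
    have hf' : ∀ x, p (f x) = h x := fun x => LinearMap.congr_fun hf x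
    obtain ⟨k, hk⟩ := Module.projective_lifting_property j.rangeRestrict
      (LinearMap.codRestrict (LinearMap.range j) (f ∘ₗ i)
      (fun x => (hjp _).1 (by simp [hf', hh]))) j.surjective_rangeRestrict
    have hk2 : ∀ x, j (k x) = f (i x) := fun x => congrArg Subtype.val (LinearMap.congr_fun hk x)
    obtain ⟨k', hk'⟩ := hY.2 k
    have := hY'.1 (f - j ∘ₗ k') (fun x => by simp [hk', hk2]) x
    rw [← hf']
    rw [hjp]
    refine ⟨k' x, ?_⟩
    exact (sub_eq_zero.1 this).symm
  · intro g
    obtain ⟨f, hf⟩ := Module.projective_lifting_property p g hp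
    obtain ⟨f', hf'⟩ := hY'.2 f
    exact ⟨p ∘ₗ f', fun x => by simpa [hf'] using LinearMap.congr_fun hf x⟩

lemma res_directSum {P Q : Type u} [AddCommGroup P] [Module A P] [AddCommGroup Q] [Module A Q]
    [Module.Finite A P]
    (i : P →ₗ[A] Q) {ι : Type u} (Y : ι → Type u) [∀ k, AddCommGroup (Y k)]
    [∀ k, Module A (Y k)] (h : ∀ k, Res i (Y k)) : Res i (DirectSum ι Y) := by
  classical
  constructor
  · intro f hf x
    refine DFinsupp.ext fun k => ?_
    exact (h k).1 (DirectSum.component A ι Y k ∘ₗ f) (fun x => by simp [hf]) x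
  · intro g
    choose f hf using fun k => (h k).2 (DirectSum.component A ι Y k ∘ₗ g)
    obtain ⟨T, hT⟩ := Module.Finite.fg_top (R := A) (M := P)
    let U : Finset ι := T.biUnion fun t => DFinsupp.support (g t)
    refine ⟨∑ k ∈ U, DirectSum.lof A ι Y k ∘ₗ f k, ?_⟩
    have key : (∑ k ∈ U, DirectSum.lof A ι Y k ∘ₗ f k) ∘ₗ i = g := by
      apply LinearMap.ext_on hT
      intro t ht
      have hf' : ∀ k, f k (i t) = g t k := fun k => hf k t
      simp only [LinearMap.comp_apply, LinearMap.sum_apply, hf']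
      refine DFinsupp.ext fun k => ?_
      rw [DFinsupp.finsetSum_apply]
      by_cases hk : k ∈ U
      · rw [Finset.sum_eq_single k]
        · exact DirectSum.lof_apply A k _
        · intro b _ hb
          exact DFinsupp.single_eq_of_ne (Ne.symm hb)
        · intro h; exact absurd hk h
      · rw [Finset.sum_eq_zero]
        · symm
          by_contra hne
          exact hk (Finset.mem_biUnion.2 ⟨t, ht, DFinsupp.mem_support_iff.2 hne⟩)
        · intro b hb
          refine DFinsupp.single_eq_of_ne ?_
          rintro rfl; exact hk hb
    exact fun x => LinearMap.congr_fun key x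

/-- Closure properties of the right hand class. -/
structure Closed (𝒴 : Set (ModuleCat.{u} A)) : Prop where
  pi : ∀ (ι : Type u) (g : ι → ModuleCat.{u} A), (∀ i, g i ∈ 𝒴) →
    ModuleCat.of A (∀ i, g i) ∈ 𝒴
  sum : ∀ (ι : Type u) (g : ι → ModuleCat.{u} A), (∀ i, g i ∈ 𝒴) →
    ModuleCat.of A (DirectSum ι (fun i => g i)) ∈ 𝒴
  ext : ∀ (Y Y' Z : ModuleCat.{u} A) (j : Y →ₗ[A] Y') (p : Y' →ₗ[A] Z),
    Function.Injective j → Function.Surjective p → (∀ y, p y = 0 ↔ ∃ x, j x = y) →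
    Y ∈ 𝒴 → Z ∈ 𝒴 → Y' ∈ 𝒴
  coker : ∀ (Y Y' Z : ModuleCat.{u} A) (j : Y →ₗ[A] Y') (p : Y' →ₗ[A] Z),
    Function.Surjective p → (∀ y, p y = 0 ↔ ∃ x, j x = y) →
    Y ∈ 𝒴 → Y' ∈ 𝒴 → Z ∈ 𝒴

/-- The intersection of the kernels of all maps to objects of `𝒴` killing `P`. -/
def reject (𝒴 : Set (ModuleCat.{u} A)) {V : Type u} [AddCommGroup V] [Module A V]
    (P : Submodule A V) : Submodule A V where
  carrier := {x | ∀ Y ∈ 𝒴, ∀ f : V →ₗ[A] Y, (∀ y ∈ P, f y = 0) → f x = 0}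
  add_mem' := by
    intro a b ha hb Y hY f hf
    rw [map_add, ha Y hY f hf, hb Y hY f hf, add_zero]
  zero_mem' := by
    intro Y hY f hf
    exact map_zero f
  smul_mem' := by
    intro c a ha Y hY f hf
    rw [map_smul, ha Y hY f hf, smul_zero]

lemma reject_inj (hA : IsHereditaryRing A) {𝒴 : Set (ModuleCat.{u} A)} (hc : Closed 𝒴)
    {V : Type u} [AddCommGroup V] [Module A V] (hV : Module.Projective A V)
    (P : Submodule A V) (Y : ModuleCat.{u} A) (hY : Y ∈ 𝒴)
    (g : reject 𝒴 P →ₗ[A] Y) (hg : ∀ (x : V) (hx : x ∈ P) (hx' : x ∈ reject 𝒴 P), g ⟨x, hx'⟩ = 0) :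
    ∀ x, g x = 0 := by
  classical
  have hch : ∀ x : {x : V // x ∉ reject 𝒴 P}, ∃ W : ModuleCat.{u} A, W ∈ 𝒴 ∧ ∃ f : V →ₗ[A] W,
      (∀ y ∈ P, f y = 0) ∧ f x ≠ 0 := by
    rintro ⟨x, hx⟩
    by_contra hcon
    apply hx
    intro W hW f hf
    by_contra hne
    exact hcon ⟨W, hW, f, hf, hne⟩
  choose W hW f hf hne using hch
  let Z : Type u := ∀ i, W i
  have hZ : ModuleCat.of A Z ∈ 𝒴 := hc.pi _ W hW
  let F : Type u := Z →₀ A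
  let q : F →ₗ[A] Z := Finsupp.linearCombination A id
  have hq : Function.Surjective q := Finsupp.linearCombination_id_surjective A Z
  have hF : Module.Projective A F := inferInstanceAs (Module.Projective A (Z →₀ A))
  let G := LinearMap.ker q
  obtain ⟨l, hl⟩ := Module.projective_lifting_property q (LinearMap.pi f) hq
  have hl' : ∀ x, q (l x) = fun i => f i x := fun x => LinearMap.congr_fun hl x
  have hcomap : G.comap l = reject 𝒴 P := by
    ext x
    rw [Submodule.mem_comap, LinearMap.mem_ker, hl']
    constructor
    · intro h
      by_contra hx
      exact hne ⟨x, hx⟩ (congrFun h ⟨x, hx⟩)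
    · intro h
      funext i
      exact h _ (hW i) (f i) (hf i)
  have hmem : ∀ x, x ∈ G.comap l → x ∈ reject 𝒴 P := fun x hx => hcomap ▸ hx
  obtain ⟨a, b, hab⟩ := split_pair hA hF l G (g ∘ₗ Submodule.inclusion hcomap.le)
  have hab' : ∀ (x : V) (h : l x ∈ G), a x + b ⟨l x, h⟩ = g ⟨x, hmem x h⟩ := fun x h => hab x h
  let i0 : G →ₗ[A] (Y × F) := LinearMap.prod (-b) G.subtype
  let R := LinearMap.range i0
  let Y' : Type u := (Y × F) ⧸ R
  have hR : ∀ (y : Y) (x : F), (y, x) ∈ R ↔ ∃ h : x ∈ G, y = - b ⟨x, h⟩ := by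
    intro y x
    constructor
    · rintro ⟨z, hz⟩
      have h1 : -b z = y := congrArg Prod.fst hz
      have h2 : (z : F) = x := congrArg Prod.snd hz
      subst h2
      exact ⟨z.2, h1.symm⟩
    · rintro ⟨h, rfl⟩
      exact ⟨⟨x, h⟩, rfl⟩
  let j : Y →ₗ[A] Y' := R.mkQ ∘ₗ LinearMap.inl A Y F
  have hj0 : ∀ y, j y = 0 → y = 0 := by
    intro y hy
    have : (y, (0 : F)) ∈ R := (Submodule.Quotient.mk_eq_zero R).1 hy
    obtain ⟨h, hy⟩ := (hR _ _).1 this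
    rw [hy]
    have : (⟨0, h⟩ : G) = 0 := rfl
    rw [this, map_zero, neg_zero]
  let p : Y' →ₗ[A] Z := R.liftQ (q ∘ₗ LinearMap.snd A Y F) (by
    rintro ⟨y, x⟩ h
    obtain ⟨h, -⟩ := (hR _ _).1 h
    exact h)
  have hp : ∀ y x, p (R.mkQ (y, x)) = q x := fun y x => rfl
  have hY' : ModuleCat.of A Y' ∈ 𝒴 := by
    refine hc.ext Y (ModuleCat.of A Y') (ModuleCat.of A Z) j p ?_ ?_ ?_ hY hZ
    · intro y y' h
      rw [← sub_eq_zero]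
      apply hj0
      rw [map_sub, h, sub_self]
    · intro z
      obtain ⟨x, rfl⟩ := hq z
      exact ⟨R.mkQ (0, x), rfl⟩
    · intro y
      obtain ⟨⟨y, x⟩, rfl⟩ := R.mkQ_surjective y
      constructor
      · intro h
        have h' : x ∈ G := h
        refine ⟨y + b ⟨x, h'⟩, Eq.symm ?_⟩
        refine (Submodule.Quotient.eq R).2 ?_
        have : ((y, x) - (LinearMap.inl A Y F) (y + b ⟨x, h'⟩)) = (-b ⟨x, h'⟩, x) := by
          simp
        rw [this]
        exact (hR _ _).2 ⟨h', rfl⟩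
      · rintro ⟨y', h⟩
        rw [← h]
        change q 0 = 0
        exact map_zero q
  let m : V →ₗ[A] Y' := R.mkQ ∘ₗ LinearMap.prod a l
  have hm : ∀ (x : V) (h : l x ∈ G), m x = j (g ⟨x, hmem x h⟩) := by
    intro x h
    refine (Submodule.Quotient.eq R).2 ?_
    have : (LinearMap.prod a l) x - (LinearMap.inl A Y F) (g ⟨x, hmem x h⟩)
      = (-b ⟨l x, h⟩, l x) := by
      rw [← hab' x h]
      simp
    rw [this]
    exact (hR _ _).2 ⟨h, rfl⟩
  intro x
  have hx : l x ∈ G := hcomap.ge x.2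
  apply hj0
  rw [show x = ⟨x.1, hmem _ hx⟩ from rfl, ← hm x.1 hx]
  refine x.2 (ModuleCat.of A Y') hY' m ?_
  intro y hy
  have hy' : y ∈ reject 𝒴 P := fun Y hY f hf => hf y hy
  have hy2 : l y ∈ G := hcomap.ge hy'
  rw [hm y hy2, hg y hy, map_zero]


lemma claim3 (hA : IsHereditaryRing A) {𝒴 : Set (ModuleCat.{u} A)} (hc : Closed 𝒴)
    {V : Type u} [AddCommGroup V] [Module A V] (hV : Module.Projective A V)
    (P : Submodule A V) (hP : P.FG)
    (hext : ∀ Y ∈ 𝒴, ∀ g : P →ₗ[A] Y, ∃ f : V →ₗ[A] Y, ∀ x : P, f x = g x)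
    (S : Submodule A V) (hS : S.FG) (hSR : S ≤ reject 𝒴 P) :
    ∃ (D : Submodule A V) (hPD : P ≤ D), S ≤ D ∧ D.FG ∧
      ∀ Y ∈ 𝒴, Res (Submodule.inclusion hPD) Y := by
  have hPR : P ≤ reject 𝒴 P := fun y hy Y hY f hf => hf y hy
  have hR : Module.Projective A (reject 𝒴 P) := hA V hV _
  have hSP : (S ⊔ P) ≤ reject 𝒴 P := sup_le hSR hPR
  let T : Submodule A (reject 𝒴 P) := (S ⊔ P).comap (reject 𝒴 P).subtype
  have hTmap : T.map (reject 𝒴 P).subtype = S ⊔ P := by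
    rw [Submodule.map_comap_subtype]
    exact inf_eq_right.2 hSP
  have hT : T.FG := by
    refine Submodule.fg_of_fg_map_injective (reject 𝒴 P).subtype Subtype.val_injective ?_
    rw [hTmap]
    exact hS.sup hP
  obtain ⟨D, hTD, hD, ρ, hρ⟩ := exists_summand hA T hT
  have hle : S ⊔ P ≤ D.map (reject 𝒴 P).subtype := by
    rw [← hTmap]
    exact Submodule.map_mono hTD
  have hPD : P ≤ D.map (reject 𝒴 P).subtype := le_sup_right.trans hle
  refine ⟨D.map (reject 𝒴 P).subtype, hPD, le_sup_left.trans hle, hD.map _, ?_⟩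
  intro Y hY
  constructor
  · intro f hf
    let ι : D →ₗ[A] D.map (reject 𝒴 P).subtype :=
      LinearMap.codRestrict _ ((reject 𝒴 P).subtype ∘ₗ D.subtype)
        (fun x => Submodule.mem_map_of_mem x.2)
    have h0 : ∀ x, (f ∘ₗ ι ∘ₗ ρ) x = 0 := by
      apply reject_inj hA hc hV P Y hY
      intro x hx hx'
      have hxD : (⟨x, hx'⟩ : reject 𝒴 P) ∈ D := hTD (show x ∈ S ⊔ P from le_sup_right (a := S) hx)
      have : ρ ⟨x, hx'⟩ = ⟨⟨x, hx'⟩, hxD⟩ := hρ ⟨⟨x, hx'⟩, hxD⟩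
      change f (ι (ρ ⟨x, hx'⟩)) = 0
      rw [this]
      exact hf ⟨x, hx⟩
    rintro ⟨x, hx⟩
    obtain ⟨y, hy, rfl⟩ := hx
    have := h0 y
    have h2 : ρ y = ⟨y, hy⟩ := hρ ⟨y, hy⟩
    change f (ι (ρ y)) = 0 at this
    rw [h2] at this
    exact this
  · intro g
    obtain ⟨f, hf⟩ := hext Y hY g
    exact ⟨f ∘ₗ Submodule.subtype _, fun x => hf x⟩

/-- Finite pieces of a presentation of `X`. -/
structure GoodPair (𝒴 : Set (ModuleCat.{u} A)) {Q : Type u} [AddCommGroup Q] [Module A Q]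
    (K : Submodule A Q) where
  Q1 : Submodule A Q
  P1 : Submodule A Q
  Q1_fg : Q1.FG
  P1_fg : P1.FG
  le : P1 ≤ Q1
  leK : P1 ≤ K
  ext : ∀ Y ∈ 𝒴, ∀ g : P1 →ₗ[A] Y, ∃ f : Q1 →ₗ[A] Y, ∀ (x : Q) (h : x ∈ P1) (h' : x ∈ Q1),
    f ⟨x, h'⟩ = g ⟨x, h⟩

section good
variable {𝒴 : Set (ModuleCat.{u} A)} {Q : Type u} [AddCommGroup Q] [Module A Q]
    {K : Submodule A Q}

instance : Preorder (GoodPair 𝒴 K) where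
  le i j := i.Q1 ≤ j.Q1 ∧ i.P1 ≤ j.P1
  le_refl i := ⟨le_rfl, le_rfl⟩
  le_trans i j k h h' := ⟨h.1.trans h'.1, h.2.trans h'.2⟩

lemma good_exists (hA : IsHereditaryRing A) (hQ : Module.Projective A Q)
    (hK : ∀ Y ∈ 𝒴, Res K.subtype Y) (Q1 P0 : Submodule A Q) (hQ1 : Q1.FG) (hP0 : P0.FG)
    (h1 : P0 ≤ Q1) (h2 : P0 ≤ K) :
    ∃ i : GoodPair 𝒴 K, i.Q1 = Q1 ∧ P0 ≤ i.P1 := by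
  let P : Submodule A Q := Q1 ⊓ K
  have hP : Module.Projective A P := hA Q hQ _
  have h12 : P0 ≤ P := le_inf h1 h2
  let T : Submodule A P := P0.comap P.subtype
  have hTmap : T.map P.subtype = P0 := by
    rw [Submodule.map_comap_subtype]
    exact inf_eq_right.2 h12
  have hT : T.FG := by
    refine Submodule.fg_of_fg_map_injective P.subtype Subtype.val_injective ?_
    rw [hTmap]
    exact hP0
  obtain ⟨D, hTD, hD, ρ, hρ⟩ := exists_summand hA T hT
  have hle : P0 ≤ D.map P.subtype := by
    rw [← hTmap]
    exact Submodule.map_mono hTD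
  have hDP : D.map P.subtype ≤ P := Submodule.map_subtype_le _ _
  refine ⟨⟨Q1, D.map P.subtype, hQ1, hD.map _, hDP.trans inf_le_left, hDP.trans inf_le_right, ?_⟩,
    rfl, hle⟩
  intro Y hY g
  let ι : D →ₗ[A] D.map P.subtype :=
    LinearMap.codRestrict _ (P.subtype ∘ₗ D.subtype)
        (fun x => Submodule.mem_map_of_mem x.2)
  let c : K.comap Q1.subtype →ₗ[A] P :=
    LinearMap.codRestrict _ (Q1.subtype ∘ₗ (K.comap Q1.subtype).subtype)
      (fun x => ⟨x.1.2, x.2⟩)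
  obtain ⟨a, b, hab⟩ := split_pair hA hQ Q1.subtype K (g ∘ₗ ι ∘ₗ ρ ∘ₗ c)
  obtain ⟨b', hb'⟩ := (hK Y hY).2 b
  refine ⟨a + b' ∘ₗ Q1.subtype, ?_⟩
  intro x h h'
  have hxK : x ∈ K := (hDP h).2
  have h3 := hab ⟨x, h'⟩ hxK
  have h4 : b' x = b ⟨x, hxK⟩ := hb' ⟨x, hxK⟩
  change a ⟨x, h'⟩ + b' x = _
  rw [h4]
  refine h3.trans ?_
  obtain ⟨y, hy, hyx⟩ := h
  have h5 : ρ y = ⟨y, hy⟩ := hρ ⟨y, hy⟩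
  have h6 : c ⟨⟨x, h'⟩, hxK⟩ = y := Subtype.ext hyx.symm
  change g (ι (ρ (c ⟨⟨x, h'⟩, hxK⟩))) = _
  rw [h6, h5]
  congr 1
  exact Subtype.ext hyx

lemma good_directed (hA : IsHereditaryRing A) (hQ : Module.Projective A Q)
    (hK : ∀ Y ∈ 𝒴, Res K.subtype Y) (i j : GoodPair 𝒴 K) : ∃ k, i ≤ k ∧ j ≤ k := by
  obtain ⟨k, hk1, hk2⟩ := good_exists hA hQ hK (i.Q1 ⊔ j.Q1) (i.P1 ⊔ j.P1) (i.Q1_fg.sup j.Q1_fg)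
    (i.P1_fg.sup j.P1_fg) (sup_le_sup i.le j.le) (sup_le i.leK j.leK)
  exact ⟨k, ⟨hk1 ▸ le_sup_left, le_sup_left.trans hk2⟩, ⟨hk1 ▸ le_sup_right, le_sup_right.trans hk2⟩⟩

lemma good_ge (hA : IsHereditaryRing A) (hQ : Module.Projective A Q)
    (hK : ∀ Y ∈ 𝒴, Res K.subtype Y) (i0 : GoodPair 𝒴 K) (q : Q) :
    ∃ i, i0 ≤ i ∧ q ∈ i.Q1 ∧ (q ∈ K → q ∈ i.P1) := by
  by_cases hq : q ∈ K
  · obtain ⟨k, hk1, hk2⟩ := good_exists hA hQ hK (i0.Q1 ⊔ A ∙ q) (i0.P1 ⊔ A ∙ q)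
      (i0.Q1_fg.sup (Submodule.fg_span_singleton q)) (i0.P1_fg.sup (Submodule.fg_span_singleton q))
      (sup_le_sup i0.le le_rfl) (sup_le i0.leK (by simpa using hq))
    have hqq : q ∈ k.P1 := hk2 (Submodule.mem_sup_right (Submodule.mem_span_singleton_self q))
    exact ⟨k, ⟨hk1 ▸ le_sup_left, le_sup_left.trans hk2⟩, k.le hqq, fun _ => hqq⟩
  · obtain ⟨k, hk1, hk2⟩ := good_exists hA hQ hK (i0.Q1 ⊔ A ∙ q) i0.P1
      (i0.Q1_fg.sup (Submodule.fg_span_singleton q)) i0.P1_fg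
      (i0.le.trans le_sup_left) i0.leK
    exact ⟨k, ⟨hk1 ▸ le_sup_left, hk2⟩,
      hk1 ▸ (Submodule.mem_sup_right (Submodule.mem_span_singleton_self q)), fun h => absurd h hq⟩

lemma redprod {𝒴 : Set (ModuleCat.{u} A)} (hc : Closed 𝒴) {I : Type u} [Preorder I]
    (Y : I → ModuleCat.{u} A) (hY : ∀ i, Y i ∈ 𝒴)
    (N : Submodule A (∀ i, Y i)) (hN : ∀ y, y ∈ N ↔ ∃ j, ∀ i, j ≤ i → y i = 0) :
    ModuleCat.of A ((∀ i, Y i) ⧸ N) ∈ 𝒴 := by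
  classical
  let B : I → ModuleCat.{u} A := fun j => ModuleCat.of A (∀ i : {i // ¬ j ≤ i}, Y i.1)
  let e : ∀ j, (∀ i : {i // ¬ j ≤ i}, Y i.1) →ₗ[A] (∀ i, Y i) := fun j => LinearMap.pi fun i =>
    if h : j ≤ i then 0 else LinearMap.proj (R := A) (φ := fun i : {i // ¬ j ≤ i} => Y i.1) ⟨i, h⟩
  let t : DirectSum I (fun j => B j) →ₗ[A] (∀ i, Y i) := DirectSum.toModule A I _ e
  refine hc.coker (ModuleCat.of A (DirectSum I (fun j => B j))) (ModuleCat.of A (∀ i, Y i)) _ t N.mkQ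
    N.mkQ_surjective ?_ (hc.sum I B fun j => hc.pi _ _ fun i => hY i.1) (hc.pi _ _ hY)
  intro y
  have h1 : N.mkQ y = 0 ↔ y ∈ N := Submodule.Quotient.mk_eq_zero N
  refine h1.trans ?_
  constructor
  · intro hy
    obtain ⟨j, hj⟩ := (hN y).1 hy
    refine ⟨DirectSum.lof A I (fun j => B j) j (fun i => y i.1), ?_⟩
    change DirectSum.toModule A I _ e _ = y
    rw [DirectSum.toModule_lof]
    funext i
    by_cases h : j ≤ i
    · simp [e, h, hj i h]
    · simp [e, h]
  · rintro ⟨x, rfl⟩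
    have hle : LinearMap.range t ≤ N := by
      rw [LinearMap.range_eq_map, Submodule.map_le_iff_le_comap]
      intro x _
      induction x using DirectSum.induction_on with
      | zero => exact Submodule.zero_mem _
      | of j z =>
        refine (hN _).2 ⟨j, fun i hi => ?_⟩
        change DirectSum.toModule A I _ e (DirectSum.lof A I (fun j => B j) j z) i = 0
        rw [DirectSum.toModule_lof]
        simp [e, hi]
      | add x y hx hy => exact Submodule.add_mem _ (hx trivial) (hy trivial)
    exact hle ⟨x, rfl⟩

lemma claim2 (hA : IsHereditaryRing A) (hc : Closed 𝒴) (hQ : Module.Projective A Q)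
    (hK : ∀ Y ∈ 𝒴, Res K.subtype Y) (i0 : GoodPair 𝒴 K) :
    ∃ i, i0 ≤ i ∧ ∀ Y ∈ 𝒴, ∀ f : i.Q1 →ₗ[A] Y,
      (∀ (x : Q) (_ : x ∈ i.P1) (h' : x ∈ i.Q1), f ⟨x, h'⟩ = 0) →
      ∀ (x : Q) (_ : x ∈ i0.Q1) (h' : x ∈ i.Q1), f ⟨x, h'⟩ = 0 := by
  classical
  by_contra hcon
  have hch : ∀ i : {i : GoodPair 𝒴 K // i0 ≤ i}, ∃ Y : ModuleCat.{u} A, Y ∈ 𝒴 ∧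
      ∃ f : i.1.Q1 →ₗ[A] Y,
      (∀ (x : Q) (_ : x ∈ i.1.P1) (h' : x ∈ i.1.Q1), f ⟨x, h'⟩ = 0) ∧
      ¬ ∀ (x : Q) (_ : x ∈ i0.Q1) (h' : x ∈ i.1.Q1), f ⟨x, h'⟩ = 0 := by
    rintro ⟨i, hi⟩
    by_contra h2
    apply hcon
    refine ⟨i, hi, fun Y hY f hf => ?_⟩
    by_contra h3
    exact h2 ⟨Y, hY, f, hf, h3⟩
  choose Y hY f hf hne using hch
  have hdir : ∀ i j : {i : GoodPair 𝒴 K // i0 ≤ i}, ∃ k, i ≤ k ∧ j ≤ k := by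
    intro i j
    obtain ⟨k, hk1, hk2⟩ := good_directed hA hQ hK i.1 j.1
    exact ⟨⟨k, i.2.trans hk1⟩, hk1, hk2⟩
  have hge : ∀ (q : Q), ∃ i : {i : GoodPair 𝒴 K // i0 ≤ i}, ∀ j, i ≤ j →
      q ∈ j.1.Q1 ∧ (q ∈ K → q ∈ j.1.P1) := by
    intro q
    obtain ⟨i, hi, h1, h2⟩ := good_ge hA hQ hK i0 q
    exact ⟨⟨i, hi⟩, fun j hj => ⟨hj.1 h1, fun h => hj.2 (h2 h)⟩⟩
  let N : Submodule A (∀ i, Y i) :=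
    { carrier := {y | ∃ j, ∀ i, j ≤ i → y i = 0}
      add_mem' := by
        rintro a b ⟨i, hi⟩ ⟨j, hj⟩
        obtain ⟨k, hik, hjk⟩ := hdir i j
        refine ⟨k, fun l hl => ?_⟩
        rw [Pi.add_apply, hi l (hik.trans hl), hj l (hjk.trans hl), add_zero]
      zero_mem' := ⟨⟨i0, le_rfl⟩, fun i _ => rfl⟩
      smul_mem' := by
        rintro c a ⟨i, hi⟩
        refine ⟨i, fun l hl => ?_⟩
        rw [Pi.smul_apply, hi l hl, smul_zero] }
  have hN : ∀ y, y ∈ N ↔ ∃ j, ∀ i, j ≤ i → y i = 0 := fun y => Iff.rfl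
  have hT := redprod hc Y hY N hN
  let θ : Q → ∀ i, Y i := fun q i => if h : q ∈ i.1.Q1 then f i ⟨q, h⟩ else 0
  have hθ : ∀ q i (h : q ∈ i.1.Q1), θ q i = f i ⟨q, h⟩ := fun q i h => dif_pos h
  let Θ : Q →ₗ[A] ((∀ i, Y i) ⧸ N) :=
    { toFun := fun q => N.mkQ (θ q)
      map_add' := by
        intro q r
        rw [← map_add]
        refine (Submodule.Quotient.eq N).2 ?_
        obtain ⟨i, hi⟩ := hge q
        obtain ⟨j, hj⟩ := hge r
        obtain ⟨k, hik, hjk⟩ := hdir i j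
        refine ⟨k, fun l hl => ?_⟩
        have h1 := (hi l (hik.trans hl)).1
        have h2 := (hj l (hjk.trans hl)).1
        rw [Pi.sub_apply, Pi.add_apply, hθ _ _ h1, hθ _ _ h2, hθ _ _ (add_mem h1 h2), ← map_add,
          sub_eq_zero]
        rfl
      map_smul' := by
        intro c q
        rw [RingHom.id_apply, ← map_smul]
        refine (Submodule.Quotient.eq N).2 ?_
        obtain ⟨i, hi⟩ := hge q
        refine ⟨i, fun l hl => ?_⟩
        have h1 := (hi l hl).1
        rw [Pi.sub_apply, Pi.smul_apply, hθ _ _ h1, hθ _ _ (Submodule.smul_mem _ c h1), ← map_smul,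
          sub_eq_zero]
        rfl }
  have hΘ : ∀ q, Θ q = 0 := by
    refine (hK _ hT).1 Θ ?_
    rintro ⟨q, hq⟩
    refine (Submodule.Quotient.mk_eq_zero N).2 ?_
    obtain ⟨i, hi⟩ := hge q
    refine ⟨i, fun l hl => ?_⟩
    change θ q l = 0
    rw [hθ _ _ (hi l hl).1]
    exact hf l q ((hi l hl).2 hq) _
  have hev : ∀ q, ∃ j, ∀ i, j ≤ i → θ q i = 0 := fun q =>
    (Submodule.Quotient.mk_eq_zero N).1 (hΘ q)
  choose J hJ using hev
  obtain ⟨T, hTT⟩ := i0.Q1_fg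
  have : Nonempty {i : GoodPair 𝒴 K // i0 ≤ i} := ⟨⟨i0, le_rfl⟩⟩
  have : IsDirected {i : GoodPair 𝒴 K // i0 ≤ i} (· ≤ ·) := ⟨fun i j => hdir i j⟩
  obtain ⟨k, hk⟩ := Finset.exists_le (T.image J)
  apply hne k
  have hle : i0.Q1 ≤ (LinearMap.ker (f k)).map k.1.Q1.subtype := by
    rw [← hTT, Submodule.span_le]
    intro q hq
    have hq1 : q ∈ k.1.Q1 := k.2.1 (hTT ▸ Submodule.subset_span hq)
    refine ⟨⟨q, hq1⟩, ?_, rfl⟩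
    have := hJ q k (hk _ (Finset.mem_image_of_mem J hq))
    rw [hθ _ _ hq1] at this
    exact this
  intro x hx h'
  obtain ⟨y, hy, rfl⟩ := hle hx
  exact hy

end good

lemma res_congr {P Q : Type u} [AddCommGroup P] [Module A P] [AddCommGroup Q] [Module A Q]
    (i : P →ₗ[A] Q) (N : Submodule A Q)
    (hN : LinearMap.range i = N) (Y : Type u)
    [AddCommGroup Y] [Module A Y] (h : Res i Y) : Res N.subtype Y := by
  subst hN
  constructor
  · intro f hf
    exact h.1 f (fun x => hf ⟨i x, x, rfl⟩)
  · intro g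
    obtain ⟨f, hf⟩ := h.2 (g ∘ₗ i.rangeRestrict)
    refine ⟨f, ?_⟩
    rintro ⟨_, x, rfl⟩
    exact hf x

lemma key_aux [HasExt.{u} (ModuleCat.{u} A)] (hA : IsHereditaryRing A) {𝒴 : Set (ModuleCat.{u} A)}
    (hc : Closed 𝒴) {X : Type u} [AddCommGroup X] [Module A X]
    {Q : Type u} [AddCommGroup Q] [Module A Q] (hQ : Module.Projective A Q)
    (q : Q →ₗ[A] X) (hq : Function.Surjective q)
    (hK : ∀ Y ∈ 𝒴, Res (LinearMap.ker q).subtype Y)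
    {M : Type u} [AddCommGroup M] [Module A M] [Module.FinitePresentation A M]
    (φ : M →ₗ[A] X) :
    ∃ (n : ℕ) (L : Submodule A (Fin n → A)) (s : M →ₗ[A] ((Fin n → A) ⧸ L))
      (t : ((Fin n → A) ⧸ L) →ₗ[A] X), L.FG ∧
      (∀ Y ∈ 𝒴, Orth (ModuleCat.of A ((Fin n → A) ⧸ L)) Y) ∧ ∀ x, t (s x) = φ x := by
  obtain ⟨n, K, e, hKfg⟩ := Module.FinitePresentation.exists_fin A M
  obtain ⟨α, hα⟩ := Module.projective_lifting_property q
    (φ ∘ₗ e.symm.toLinearMap ∘ₗ K.mkQ) hq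
  have hα' : ∀ x, q (α x) = φ (e.symm (K.mkQ x)) := fun x => LinearMap.congr_fun hα x
  have hαK : K.map α ≤ LinearMap.ker q := by
    rintro _ ⟨x, hx, rfl⟩
    rw [LinearMap.mem_ker, hα']
    have : K.mkQ x = 0 := (Submodule.Quotient.mk_eq_zero K).2 hx
    rw [this, map_zero, map_zero]
  obtain ⟨i0, hi0, hi0'⟩ := good_exists hA hQ hK (LinearMap.range α) (K.map α)
    (by rw [LinearMap.range_eq_map]; exact Module.Finite.fg_top.map α)
    (hKfg.map α) LinearMap.map_le_range hαK
  obtain ⟨i, hi, hkill⟩ := claim2 hA hc hQ hK i0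
  have hV : Module.Projective A i.Q1 := hA Q hQ _
  let P : Submodule A i.Q1 := i.P1.comap i.Q1.subtype
  let S : Submodule A i.Q1 := i0.Q1.comap i.Q1.subtype
  have hfgc : ∀ W : Submodule A Q, W ≤ i.Q1 → W.FG → (W.comap i.Q1.subtype).FG := by
    intro W hW hfg
    refine Submodule.fg_of_fg_map_injective i.Q1.subtype Subtype.val_injective ?_
    rw [Submodule.map_comap_subtype, inf_eq_right.2 hW]
    exact hfg
  obtain ⟨D, hPD, hSD, hDfg, hres⟩ := claim3 hA hc hV P (hfgc _ i.le i.P1_fg) (by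
      intro Y hY g
      let c : i.P1 →ₗ[A] P := LinearMap.codRestrict _ (Submodule.inclusion i.le) (fun x => x.2)
      obtain ⟨f, hf⟩ := i.ext Y hY (g ∘ₗ c)
      refine ⟨f, ?_⟩
      rintro ⟨⟨x, hx⟩, hx'⟩
      exact hf x hx' hx) S (hfgc _ hi.1 i0.Q1_fg) (by
      rintro ⟨x, hx⟩ hxS Y hY f hf
      exact hkill Y hY f (fun z hz hz' => hf ⟨z, hz'⟩ hz) x hxS hx)
  have hDproj : Module.Projective A D := hA _ hV _
  have hDfin : Module.Finite A D := Module.Finite.iff_fg.2 hDfg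
  have hDfp : Module.FinitePresentation A D := Module.finitePresentation_of_projective A D
  let P' : Submodule A D := P.comap D.subtype
  have hP'r : LinearMap.range (Submodule.inclusion hPD) = P' := Submodule.range_inclusion _ _ hPD
  have hP'fg : P'.FG := by
    refine Submodule.fg_of_fg_map_injective D.subtype Subtype.val_injective ?_
    rw [Submodule.map_comap_subtype, inf_eq_right.2 hPD]
    exact hfgc _ i.le i.P1_fg
  have hCfp : Module.FinitePresentation A (D ⧸ P') :=
    Module.finitePresentation_of_surjective P'.mkQ P'.mkQ_surjective (by
      rw [Submodule.ker_mkQ]; exact hP'fg)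
  obtain ⟨m, L, e', hL⟩ := Module.FinitePresentation.exists_fin A (D ⧸ P')
  have hαS : ∀ x, α x ∈ i0.Q1 := fun x => hi0 ▸ ⟨x, rfl⟩
  let α1 : (Fin n → A) →ₗ[A] i.Q1 := LinearMap.codRestrict _ α (fun x => hi.1 (hαS x))
  let α2 : (Fin n → A) →ₗ[A] D := LinearMap.codRestrict _ α1 (fun x => hSD (hαS x))
  let s0 : ((Fin n → A) ⧸ K) →ₗ[A] (D ⧸ P') := K.liftQ (P'.mkQ ∘ₗ α2) (by
    intro x hx
    refine (Submodule.Quotient.mk_eq_zero P').2 ?_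
    exact hi.2 (hi0' ⟨x, hx, rfl⟩))
  let t0 : (D ⧸ P') →ₗ[A] X := P'.liftQ (q ∘ₗ i.Q1.subtype ∘ₗ D.subtype) (by
    intro x hx
    exact i.leK hx)
  refine ⟨m, L, e'.toLinearMap ∘ₗ s0 ∘ₗ e.toLinearMap, t0 ∘ₗ e'.symm.toLinearMap, hL, ?_, ?_⟩
  · intro Y hY
    refine (orth_iff_res hA (e'.toLinearMap ∘ₗ P'.mkQ)
      (e'.surjective.comp P'.mkQ_surjective) Y).2 ?_
    refine res_congr _ _ ?_ Y (hres Y hY)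
    rw [hP'r, LinearEquiv.ker_comp, Submodule.ker_mkQ]
  · intro x
    change t0 (e'.symm (e' (s0 (e x)))) = φ x
    rw [LinearEquiv.symm_apply_apply]
    obtain ⟨y, hy⟩ := K.mkQ_surjective (e x)
    rw [← hy]
    change q (α y) = φ x
    rw [hα', hy, LinearEquiv.symm_apply_apply]

/-- Key factorization lemma. -/
lemma key [HasExt.{u} (ModuleCat.{u} A)] (hA : IsHereditaryRing A) {𝒴 : Set (ModuleCat.{u} A)}
    (hc : Closed 𝒴) {X : Type u} [AddCommGroup X] [Module A X]
    (hX : ∀ Y ∈ 𝒴, Orth (ModuleCat.of A X) Y)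
    {M : Type u} [AddCommGroup M] [Module A M] [Module.FinitePresentation A M]
    (φ : M →ₗ[A] X) :
    ∃ (n : ℕ) (L : Submodule A (Fin n → A)) (s : M →ₗ[A] ((Fin n → A) ⧸ L))
      (t : ((Fin n → A) ⧸ L) →ₗ[A] X), L.FG ∧
      (∀ Y ∈ 𝒴, Orth (ModuleCat.of A ((Fin n → A) ⧸ L)) Y) ∧ ∀ x, t (s x) = φ x := by
  have hq := Finsupp.linearCombination_id_surjective A X
  exact key_aux hA hc (inferInstanceAs (Module.Projective A (X →₀ A))) _ hq (fun Y hY =>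
    (orth_iff_res hA _ hq Y).1 (hX Y hY)) φ

lemma fp_quot (Z : Type u) [AddCommGroup Z] [Module A Z] [Module.FinitePresentation A Z]
    (L : Submodule A Z) (hL : L.FG) : Module.FinitePresentation A (Z ⧸ L) :=
  Module.finitePresentation_of_surjective L.mkQ L.mkQ_surjective (by
    rw [Submodule.ker_mkQ]; exact hL)

section filt
variable [HasExt.{u} (ModuleCat.{u} A)]

/-- Standard finitely presented modules left orthogonal to `𝒴`. -/
structure Std (𝒴 : Set (ModuleCat.{u} A)) : Type u where
  n : ℕ
  L : Submodule A (Fin n → A)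
  fg : L.FG
  orth : ∀ Y ∈ 𝒴, Orth (ModuleCat.of A ((Fin n → A) ⧸ L)) Y

/-- The underlying module. -/
abbrev Std.toMod {𝒴 : Set (ModuleCat.{u} A)} (c : Std 𝒴) : ModuleCat.{u} A :=
  ModuleCat.of A ((Fin c.n → A) ⧸ c.L)

lemma Std.fp {𝒴 : Set (ModuleCat.{u} A)} (c : Std 𝒴) : Module.FinitePresentation A c.toMod :=
  Module.finitePresentation_of_surjective c.L.mkQ c.L.mkQ_surjective (by
    rw [Submodule.ker_mkQ]; exact c.fg)

/-- The inclusion of the standard modules. -/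
abbrev F0 (𝒴 : Set (ModuleCat.{u} A)) :
    InducedCategory (ModuleCat.{u} A) (Std.toMod (𝒴 := 𝒴)) ⥤ ModuleCat.{u} A :=
  inducedFunctor _

/-- The index category. -/
abbrev Idx (𝒴 : Set (ModuleCat.{u} A)) (X : ModuleCat.{u} A) : Type u :=
  CostructuredArrow (F0 𝒴) X

variable {𝒴 : Set (ModuleCat.{u} A)} {X : ModuleCat.{u} A}

lemma exists_idx (hA : IsHereditaryRing A) (hc : Closed 𝒴) (hX : ∀ Y ∈ 𝒴, Orth X Y)
    (Z : ModuleCat.{u} A) (hZ : Module.FinitePresentation A Z) (φ : Z ⟶ X) :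
    ∃ (W : Idx 𝒴 X) (s : Z ⟶ (F0 𝒴).obj W.left), s ≫ W.hom = φ := by
  obtain ⟨n, L, s, t, hL, ho, hst⟩ := key hA hc (X := X) hX φ.hom
  let c : InducedCategory (ModuleCat.{u} A) (Std.toMod (𝒴 := 𝒴)) := Std.mk n L hL ho
  refine ⟨CostructuredArrow.mk (S := F0 𝒴) (T := X)
    (Y := c) (ModuleCat.ofHom t), ModuleCat.ofHom s, ?_⟩
  ext x
  exact hst x

lemma exists_hom {W W' : Idx 𝒴 X} (a : (F0 𝒴).obj W.left ⟶ (F0 𝒴).obj W'.left)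
    (h : a ≫ W'.hom = W.hom) : ∃ f : W ⟶ W', (F0 𝒴).map f.left = a := by
  refine ⟨CostructuredArrow.homMk ((F0 𝒴).preimage a) ?_, ?_⟩
  · rw [Functor.map_preimage, h]
  · exact Functor.map_preimage (F0 𝒴) a

lemma Idx.fp (W : Idx 𝒴 X) : Module.FinitePresentation A ((F0 𝒴).obj W.left) := Std.fp _

lemma idx_ext {W W' : Idx 𝒴 X} (f g : W ⟶ W')
    (h : (F0 𝒴).map f.left = (F0 𝒴).map g.left) : f = g := by
  apply CostructuredArrow.hom_ext
  exact (F0 𝒴).map_injective h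

lemma idx_coeq (hA : IsHereditaryRing A) (hc : Closed 𝒴) (hX : ∀ Y ∈ 𝒴, Orth X Y)
    (W : Idx 𝒴 X) (L : Submodule A ((F0 𝒴).obj W.left)) (hL : L.FG)
    (h : ∀ x ∈ L, W.hom x = 0) :
    ∃ (W' : Idx 𝒴 X) (f : W ⟶ W'), ∀ x ∈ L, (F0 𝒴).map f.left x = 0 := by
  have := W.fp
  obtain ⟨W', s, hs⟩ := exists_idx hA hc hX (ModuleCat.of A (((F0 𝒴).obj W.left) ⧸ L))
    (fp_quot _ L hL) (ModuleCat.ofHom (L.liftQ W.hom.hom h))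
  obtain ⟨f, hf⟩ := exists_hom (W := W) (W' := W') (ModuleCat.ofHom L.mkQ ≫ s) (by
    rw [Category.assoc, hs]
    ext x
    rfl)
  refine ⟨W', f, fun x hx => ?_⟩
  rw [hf]
  change s (L.mkQ x) = 0
  have : L.mkQ x = 0 := (Submodule.Quotient.mk_eq_zero L).2 hx
  rw [this]
  exact map_zero s.hom

lemma idx_filtered (hA : IsHereditaryRing A) (hc : Closed 𝒴) (hX : ∀ Y ∈ 𝒴, Orth X Y) :
    IsFiltered (Idx 𝒴 X) := by
  have h1 : IsFilteredOrEmpty (Idx 𝒴 X) := by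
    constructor
    · intro W1 W2
      have := W1.fp
      have := W2.fp
      obtain ⟨W, s, hs⟩ := exists_idx hA hc hX
        (ModuleCat.of A ((F0 𝒴).obj W1.left × (F0 𝒴).obj W2.left)) inferInstance
        (ModuleCat.ofHom (W1.hom.hom.coprod W2.hom.hom))
      obtain ⟨f1, -⟩ := exists_hom (W := W1) (W' := W) (ModuleCat.ofHom (LinearMap.inl A _ _) ≫ s)
        (by
          rw [Category.assoc, hs]
          ext x
          change W1.hom.hom x + W2.hom.hom 0 = _
          rw [map_zero, add_zero])
      obtain ⟨f2, -⟩ := exists_hom (W := W2) (W' := W) (ModuleCat.ofHom (LinearMap.inr A _ _) ≫ s)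
        (by
          rw [Category.assoc, hs]
          ext x
          change W1.hom.hom 0 + W2.hom.hom x = _
          rw [map_zero, zero_add])
      exact ⟨W, f1, f2, trivial⟩
    · intro W1 W2 f g
      let d := ((F0 𝒴).map f.left).hom - ((F0 𝒴).map g.left).hom
      have := W1.fp
      have hcf : ∀ x, W2.hom ((F0 𝒴).map f.left x) = W1.hom x := fun x => by
        rw [← CostructuredArrow.w f]; rfl
      have hcg : ∀ x, W2.hom ((F0 𝒴).map g.left x) = W1.hom x := fun x => by
        rw [← CostructuredArrow.w g]; rfl
      obtain ⟨W, k, hk⟩ := idx_coeq hA hc hX W2 (LinearMap.range d)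
        (by rw [LinearMap.range_eq_map]; exact Module.Finite.fg_top.map d) (by
          rintro _ ⟨x, rfl⟩
          change W2.hom.hom ((F0 𝒴).map f.left x - (F0 𝒴).map g.left x) = 0
          rw [map_sub, sub_eq_zero]
          exact (hcf x).trans (hcg x).symm)
      refine ⟨W, k, ?_⟩
      apply idx_ext
      rw [CategoryTheory.Comma.comp_left, CategoryTheory.Comma.comp_left, Functor.map_comp,
        Functor.map_comp]
      ext x
      have := hk _ ⟨x, rfl⟩
      change ((F0 𝒴).map k.left).hom ((F0 𝒴).map f.left x - (F0 𝒴).map g.left x) = 0 at this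
      rw [map_sub, sub_eq_zero] at this
      exact this
  obtain ⟨W, -⟩ := exists_idx hA hc hX (ModuleCat.of A A) inferInstance 0
  exact { nonempty := ⟨W⟩ }

/-- The canonical cocone. -/
def idxCocone (𝒴 : Set (ModuleCat.{u} A)) (X : ModuleCat.{u} A) :
    Cocone (CostructuredArrow.proj (F0 𝒴) X ⋙ F0 𝒴) where
  pt := X
  ι := { app := fun W => W.hom
         naturality := fun W W' f => by
          exact (CostructuredArrow.w f).trans (Category.comp_id _).symm }

lemma idx_colimit (hA : IsHereditaryRing A) (hc : Closed 𝒴) (hX : ∀ Y ∈ 𝒴, Orth X Y) :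
    Nonempty (IsColimit (idxCocone 𝒴 X)) := by
  have := idx_filtered hA hc hX
  have : ReflectsColimitsOfShape (Idx 𝒴 X) (forget (ModuleCat.{u} A)) :=
    reflectsColimitsOfShape_of_reflectsIsomorphisms
  refine ⟨isColimitOfReflects (forget (ModuleCat.{u} A)) (Types.FilteredColimit.isColimitOf' _ _ ?_ ?_)⟩
  · intro x
    change X at x
    obtain ⟨W, s, hs⟩ := exists_idx hA hc hX (ModuleCat.of A A) inferInstance
      (ModuleCat.ofHom (LinearMap.toSpanSingleton A X x))
    refine ⟨W, s (1 : A), ?_⟩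
    change x = W.hom (s (1 : A))
    have : (s ≫ W.hom) (1 : A) = x := by
      rw [hs]
      exact one_smul A x
    exact this.symm
  · intro W x y hxy
    change (F0 𝒴).obj W.left at x y
    change W.hom.hom x = W.hom.hom y at hxy
    obtain ⟨W', f, hf⟩ := idx_coeq hA hc hX W (Submodule.span A {x - y})
      (Submodule.fg_span_singleton _) (by
        have : Submodule.span A {x - y} ≤ LinearMap.ker W.hom.hom := by
          rw [Submodule.span_singleton_le_iff_mem, LinearMap.mem_ker, map_sub, hxy, sub_self]
        exact this)
    refine ⟨W', f, ?_⟩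
    have h := hf _ (Submodule.mem_span_singleton_self _)
    change ((F0 𝒴).map f.left).hom (x - y) = 0 at h
    rw [map_sub, sub_eq_zero] at h
    exact h

end filt

section final
variable [HasExt.{u} (ModuleCat.{u} A)]

lemma mem_iff (hA : IsHereditaryRing A) (𝒳 : Set (ModuleCat.{u} A)) (Y : ModuleCat.{u} A) :
    (∀ X ∈ 𝒳, ∀ n : ℕ, Subsingleton (Abelian.Ext X Y n)) ↔
      ∀ X ∈ 𝒳, Res (A := A) (P := LinearMap.ker (Finsupp.linearCombination A (id : X → X)))
        (Q := X →₀ A) (Submodule.subtype _) Y :=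
  forall₂_congr fun X _ =>
    orth_iff_res hA _ (Finsupp.linearCombination_id_surjective A X) Y

lemma orth_iso (hA : IsHereditaryRing A) {X Y Y' : ModuleCat.{u} A} (e : Y ≅ Y')
    (h : Orth X Y) : Orth X Y' := by
  have hq := Finsupp.linearCombination_id_surjective A X
  refine (orth_iff_res hA _ hq Y').2 ?_
  have h1 := (orth_iff_res hA _ hq Y).1 h
  let l := e.toLinearEquiv
  constructor
  · intro f hf x
    have := h1.1 (l.symm.toLinearMap ∘ₗ f) (fun x => by
      change l.symm _ = 0
      rw [hf, map_zero]) x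
    exact l.symm.map_eq_zero_iff.1 this
  · intro g
    obtain ⟨f, hf⟩ := h1.2 (l.symm.toLinearMap ∘ₗ g)
    refine ⟨l.toLinearMap ∘ₗ f, fun x => ?_⟩
    change l (f _) = _
    rw [hf]
    exact l.apply_symm_apply _

lemma closed_of (hA : IsHereditaryRing A)
    (𝒳 𝒴 : Set (ModuleCat.{u} A))
    (h𝒴 : 𝒴 = {Y | ∀ X ∈ 𝒳, ∀ n : ℕ, Subsingleton (Abelian.Ext X Y n)})
    (h1 : ∀ (ι : Type u) (g : ι → ModuleCat.{u} A), (∀ i, g i ∈ 𝒴) → (∐ g) ∈ 𝒴) : Closed 𝒴 := by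
  have hm : ∀ Y : ModuleCat.{u} A, Y ∈ 𝒴 ↔
      ∀ X ∈ 𝒳, Res (A := A) (P := LinearMap.ker (Finsupp.linearCombination A (id : X → X)))
        (Q := X →₀ A) (Submodule.subtype _) Y := by
    intro Y
    rw [← mem_iff hA 𝒳 Y, h𝒴]
    rfl
  have hpr : ∀ X : ModuleCat.{u} A, Module.Projective A
      (LinearMap.ker (Finsupp.linearCombination A (id : X → X))) := fun X =>
    hA (X →₀ A) inferInstance _
  constructor
  · intro ι g hg
    refine (hm _).2 fun X hX => ?_
    exact res_pi _ (fun i => g i) (fun i => (hm _).1 (hg i) X hX)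
  · intro ι g hg
    have h2 := h1 ι g hg
    rw [h𝒴] at h2 ⊢
    intro X hX
    classical
    exact orth_iso hA (ModuleCat.coprodIsoDirectSum g) (h2 X hX)
  · intro Y Y' Z j p hj hp hjp hY hZ
    refine (hm _).2 fun X hX => ?_
    exact res_ext _ j p hj hp hjp ((hm _).1 hY X hX) ((hm _).1 hZ X hX)
  · intro Y Y' Z j p hp hjp hY hY'
    refine (hm _).2 fun X hX => ?_
    have := hpr X
    exact res_coker _ j p hp hjp ((hm _).1 hY X hX) ((hm _).1 hY' X hX)

lemma orth_coprod (hA : IsHereditaryRing A) (C : ModuleCat.{u} A)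
    (hC : Module.FinitePresentation A C) (ι : Type u) (g : ι → ModuleCat.{u} A)
    (hg : ∀ i, Orth C (g i)) : Orth C (∐ g) := by
  obtain ⟨n, K, e, hK⟩ := Module.FinitePresentation.exists_fin A C
  let q : (Fin n → A) →ₗ[A] C := e.symm.toLinearMap ∘ₗ K.mkQ
  have hq : Function.Surjective q := e.symm.surjective.comp K.mkQ_surjective
  have hk : LinearMap.ker q = K := by
    rw [LinearEquiv.ker_comp, Submodule.ker_mkQ]
  have : Module.Finite A (LinearMap.ker q) := Module.Finite.iff_fg.2 (hk ▸ hK)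
  classical
  refine orth_iso hA (ModuleCat.coprodIsoDirectSum g).symm ?_
  refine (orth_iff_res hA q hq _).2 ?_
  exact res_directSum _ (fun i => g i) fun i => (orth_iff_res hA q hq _).1 (hg i)

end final
end modules
end ExtOrth

/-- Characterization of the Ext-orthogonal pairs of finite type over a
hereditary ring: `𝒴` is closed under coproducts iff every module in `𝒳` is a filtered
colimit of finitely presented modules from `𝒳` iff `𝒴 = 𝒞^⊥` for a class `𝒞` of finitely
presented modules. -/
theorem ext_orthogonal_pair_finite_type_characterization
    {A : Type u} [Ring A] [HasExt.{u} (ModuleCat.{u} A)]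
    (hA : IsHereditaryRing A)
    (𝒳 𝒴 : Set (ModuleCat.{u} A))
    (h𝒴 : 𝒴 = {Y | ∀ X ∈ 𝒳, ∀ n : ℕ, Subsingleton (Abelian.Ext X Y n)})
    (h𝒳 : 𝒳 = {X | ∀ Y ∈ 𝒴, ∀ n : ℕ, Subsingleton (Abelian.Ext X Y n)}) :
    ((∀ (ι : Type u) (g : ι → ModuleCat.{u} A), (∀ i, g i ∈ 𝒴) → (∐ g) ∈ 𝒴) ↔
      (∀ M ∈ 𝒳, ∃ (J : Type u) (_ : SmallCategory J) (_ : IsFiltered J)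
        (F : J ⥤ ModuleCat.{u} A),
        (∀ j : J, F.obj j ∈ 𝒳 ∧ Module.FinitePresentation A (F.obj j)) ∧
        Nonempty (M ≅ colimit F))) ∧
    ((∀ (ι : Type u) (g : ι → ModuleCat.{u} A), (∀ i, g i ∈ 𝒴) → (∐ g) ∈ 𝒴) ↔
      (∃ 𝒞 : Set (ModuleCat.{u} A), (∀ C ∈ 𝒞, Module.FinitePresentation A C) ∧
        𝒴 = {Y | ∀ C ∈ 𝒞, ∀ n : ℕ, Subsingleton (Abelian.Ext C Y n)})) := by

  have h12 : (∀ (ι : Type u) (g : ι → ModuleCat.{u} A), (∀ i, g i ∈ 𝒴) → (∐ g) ∈ 𝒴) →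
      (∀ M ∈ 𝒳, ∃ (J : Type u) (_ : SmallCategory J) (_ : IsFiltered J)
        (F : J ⥤ ModuleCat.{u} A),
        (∀ j : J, F.obj j ∈ 𝒳 ∧ Module.FinitePresentation A (F.obj j)) ∧
        Nonempty (M ≅ colimit F)) := by
    intro h1 X hX
    have hc := ExtOrth.closed_of hA 𝒳 𝒴 h𝒴 h1
    have hXo : ∀ Y ∈ 𝒴, ExtOrth.Orth X Y := by
      rw [h𝒳] at hX
      exact hX
    refine ⟨ExtOrth.Idx 𝒴 X, inferInstance, ExtOrth.idx_filtered hA hc hXo,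
      CostructuredArrow.proj (ExtOrth.F0 𝒴) X ⋙ ExtOrth.F0 𝒴, ?_, ?_⟩
    · intro W
      refine ⟨?_, ExtOrth.Idx.fp W⟩
      have := ExtOrth.Std.orth (𝒴 := 𝒴) W.left
      rw [h𝒳]
      exact this
    · obtain ⟨hcol⟩ := ExtOrth.idx_colimit hA hc hXo
      exact ⟨hcol.coconePointUniqueUpToIso (colimit.isColimit _)⟩
  have h23 : (∀ M ∈ 𝒳, ∃ (J : Type u) (_ : SmallCategory J) (_ : IsFiltered J)
        (F : J ⥤ ModuleCat.{u} A),
        (∀ j : J, F.obj j ∈ 𝒳 ∧ Module.FinitePresentation A (F.obj j)) ∧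
        Nonempty (M ≅ colimit F)) →
      (∃ 𝒞 : Set (ModuleCat.{u} A), (∀ C ∈ 𝒞, Module.FinitePresentation A C) ∧
        𝒴 = {Y | ∀ C ∈ 𝒞, ∀ n : ℕ, Subsingleton (Abelian.Ext C Y n)}) := by
    intro h2
    refine ⟨{C | C ∈ 𝒳 ∧ Module.FinitePresentation A C}, fun C hC => hC.2, ?_⟩
    ext Y
    constructor
    · intro hY C hC
      rw [h𝒴] at hY
      exact hY C hC.1
    · intro hY
      rw [h𝒴]
      intro X hX
      obtain ⟨J, _, _, F, hF, ⟨e⟩⟩ := h2 X hX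
      exact ExtOrth.orth_colimit hA F X Y e (fun j => hY _ (hF j))
  have h31 : (∃ 𝒞 : Set (ModuleCat.{u} A), (∀ C ∈ 𝒞, Module.FinitePresentation A C) ∧
        𝒴 = {Y | ∀ C ∈ 𝒞, ∀ n : ℕ, Subsingleton (Abelian.Ext C Y n)}) →
      (∀ (ι : Type u) (g : ι → ModuleCat.{u} A), (∀ i, g i ∈ 𝒴) → (∐ g) ∈ 𝒴) := by
    rintro ⟨𝒞, hfp, h𝒞⟩ ι g hg
    rw [h𝒞]
    intro C hC
    refine ExtOrth.orth_coprod hA C (hfp C hC) ι g fun i => ?_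
    have := hg i
    rw [h𝒞] at this
    exact this C hC
  exact ⟨⟨h12, fun h2 => h31 (h23 h2)⟩, ⟨fun h1 => h23 (h12 h1), h31⟩⟩
end

section
/- Let A be a ring and 𝒴 any class of A-modules. Let X be an A-module admitting a short exact sequence 0 → P → Q → X → 0 with P and Q projective and satisfying Ext_A^1(X, Y) = 0 for all Y ∈ 𝒴. Then X is a filtered colimit of finitely presented A-modules X_i such that each X_i admits a short exact sequence 0 → P_i → Q_i → X_i → 0 with P_i, Q_i finitely generated projective and satisfies Ext_A^1(X_i, Y) = 0 for all Y ∈ 𝒴; i.e. there are a small filtered category J and a functor F : J → Mod A, all of whose values have these two properties, with X ≅ colim F. -/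
open CategoryTheory CategoryTheory.Limits

universe u

namespace FilteredColimitFP

section Criterion

variable {A : Type u} [Ring A] [HasExt.{u} (ModuleCat.{u} A)]

/-- `Ext¹(X₃, Y) = 0` allows extending maps along `X₁ → X₂`. -/
lemma exists_extension {S : ShortComplex (ModuleCat.{u} A)} (hS : S.ShortExact)
    (Y : ModuleCat.{u} A) [Subsingleton (Abelian.Ext S.X₃ Y 1)] (h : S.X₁ ⟶ Y) :
    ∃ k : S.X₂ ⟶ Y, S.f ≫ k = h := by
  obtain ⟨x, hx⟩ := Abelian.Ext.contravariant_sequence_exact₁ hS Y (Abelian.Ext.mk₀ h)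
    (n₁ := 1) rfl (Subsingleton.elim _ _)
  obtain ⟨k, rfl⟩ := (Abelian.Ext.mk₀_bijective _ _).2 x
  rw [Abelian.Ext.mk₀_comp_mk₀] at hx
  exact ⟨k, (Abelian.Ext.mk₀_bijective _ _).1 hx⟩

/-- Conversely, if `X₂` is projective then the extension property gives `Ext¹(X₃, Y) = 0`. -/
lemma subsingleton_ext {S : ShortComplex (ModuleCat.{u} A)} (hS : S.ShortExact)
    [Projective S.X₂] (Y : ModuleCat.{u} A)
    (H : ∀ h : S.X₁ ⟶ Y, ∃ k : S.X₂ ⟶ Y, S.f ≫ k = h) :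
    Subsingleton (Abelian.Ext S.X₃ Y 1) := by
  refine subsingleton_of_forall_eq 0 fun x => ?_
  obtain ⟨y, rfl⟩ := Abelian.Ext.contravariant_sequence_exact₃ hS Y x
    (Abelian.Ext.eq_zero_of_projective _) (n₀ := 0) rfl
  obtain ⟨h, rfl⟩ := (Abelian.Ext.mk₀_bijective _ _).2 y
  obtain ⟨k, rfl⟩ := H h
  rw [← Abelian.Ext.mk₀_comp_mk₀]
  exact hS.extClass_comp_assoc _

end Criterion

section Swindle

variable {A : Type u} [Ring A]

/-- Splitting finitely supported functions with values in a product. -/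
noncomputable def finsuppProdEquiv (ι : Type*) (M K : Type*) [AddCommGroup M] [Module A M]
    [AddCommGroup K] [Module A K] : (ι →₀ (M × K)) ≃ₗ[A] (ι →₀ M) × (ι →₀ K) :=
  LinearEquiv.ofLinearMap
    ((Finsupp.mapRange.linearMap (LinearMap.fst A M K)).prod
      (Finsupp.mapRange.linearMap (LinearMap.snd A M K)))
    ((Finsupp.mapRange.linearMap (LinearMap.inl A M K)).coprod
      (Finsupp.mapRange.linearMap (LinearMap.inr A M K)))
    (by ext <;> simp)
    (by ext <;> simp)

/-- Shifting. -/
noncomputable def shiftEquiv (M : Type*) [AddCommGroup M] [Module A M] :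
    (M × (ℕ →₀ M)) ≃ₗ[A] (ℕ →₀ M) :=
  ((Finsupp.uniqueLinearEquiv A M ()).symm.prodCongr (LinearEquiv.refl A _)).trans
    ((Finsupp.sumFinsuppLEquivProdFinsupp A).symm.trans
      (Finsupp.domLCongr ((Equiv.sumComm _ _).trans Equiv.natSumPUnitEquivNat)))

lemma exists_free_compl_aux (L M : Type u) [AddCommGroup L] [Module A L] [Module.Free A L]
    [AddCommGroup M] [Module A M] (p : L →ₗ[A] M) (s : M →ₗ[A] L) (hs : p ∘ₗ s = LinearMap.id) :
    ∃ (F : Type u) (_ : AddCommGroup F) (_ : Module A F), Module.Free A F ∧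
      Module.Free A (M × F) := by
  let K := LinearMap.ker p
  have hps : ∀ x, p (s x) = x := fun x => LinearMap.congr_fun hs x
  let e : L ≃ₗ[A] M × K :=
    LinearEquiv.ofLinearMap
      (p.prod ((LinearMap.id - s ∘ₗ p).codRestrict K (fun x => by
        simp [K, LinearMap.mem_ker, hps])))
      (s.coprod K.subtype)
      (by
        apply LinearMap.ext
        rintro ⟨x, y, hy⟩
        have hy' : p y = 0 := hy
        ext1
        · simp [hps, hy']
        · apply Subtype.ext
          simp [hps, hy'])
      (by
        apply LinearMap.ext
        intro x
        simp)
  refine ⟨ℕ →₀ (M × K), inferInstance, inferInstance, ?_, ?_⟩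
  · exact Module.Free.of_equiv (Finsupp.mapRange.linearEquiv (α := ℕ) e)
  · let e' : (M × (ℕ →₀ (M × K))) ≃ₗ[A] (ℕ →₀ (M × K)) :=
      ((LinearEquiv.refl A M).prodCongr (finsuppProdEquiv ℕ M K)).trans
        ((LinearEquiv.prodAssoc A M (ℕ →₀ M) (ℕ →₀ K)).symm.trans
          (((shiftEquiv M).prodCongr (LinearEquiv.refl A _)).trans
            (finsuppProdEquiv ℕ M K).symm))
    exact Module.Free.of_equiv ((Finsupp.mapRange.linearEquiv (α := ℕ) e).trans e'.symm)

lemma exists_free_compl (M : Type u) [AddCommGroup M] [Module A M] [Module.Projective A M] :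
    ∃ (F : Type u) (_ : AddCommGroup F) (_ : Module A F), Module.Free A F ∧
      Module.Free A (M × F) := by
  obtain ⟨s, hs⟩ := LinearMap.exists_rightInverse_of_surjective
    (Finsupp.linearCombination A (id : M → M))
    (LinearMap.range_eq_top.2 (Finsupp.linearCombination_id_surjective A M))
  exact exists_free_compl_aux (M →₀ A) M _ s hs

end Swindle

section Free

variable {A : Type u} [Ring A]

/-- The submodule spanned by a part of a basis. -/
noncomputable def Sub {ι L : Type u} [AddCommGroup L] [Module A L] (b : Module.Basis ι A L) (s : Finset ι) :
    Submodule A L :=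
  (Finsupp.supported A A (s : Set ι)).comap (b.repr : L →ₗ[A] (ι →₀ A))

section Sub

variable {ι L : Type u} [AddCommGroup L] [Module A L] (b : Module.Basis ι A L)

lemma mem_sub {s : Finset ι} {x : L} : x ∈ Sub b s ↔ (b.repr x).support ⊆ s :=
  Finset.coe_subset

lemma sub_mono {s t : Finset ι} (h : s ⊆ t) : Sub b s ≤ Sub b t := fun _ hx =>
  (mem_sub b).2 (((mem_sub b).1 hx).trans h)

/-- The submodule is free on the subset. -/
noncomputable def subEquiv (s : Finset ι) : Sub b s ≃ₗ[A] (s →₀ A) :=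
  (b.repr.ofSubmodule' (Finsupp.supported A A (s : Set ι))).trans
    (Finsupp.supportedEquivFinsupp (M := A) (R := A) (s : Set ι))

instance (s : Finset ι) : Module.Free A (Sub b s) := Module.Free.of_equiv (subEquiv b s).symm

instance (s : Finset ι) : Module.Finite A (Sub b s) := Module.Finite.equiv (subEquiv b s).symm

lemma exists_retraction (s : Finset ι) :
    ∃ r : L →ₗ[A] Sub b s, ∀ x : Sub b s, r x = x := by
  classical
  refine ⟨(b.repr.ofSubmodule' (Finsupp.supported A A (s : Set ι))).symm.toLinearMap ∘ₗ
    Finsupp.restrictDom A A (s : Set ι) ∘ₗ b.repr.toLinearMap, fun x => ?_⟩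
  refine (LinearEquiv.symm_apply_eq _).2 ?_
  exact LinearMap.congr_fun (Finsupp.restrictDom_comp_subtype (M := A) (R := A)
    (s : Set ι)) ⟨b.repr x.1, x.2⟩

lemma sub_le {s : Finset ι} {N : Submodule A L} (h : ∀ i ∈ s, b i ∈ N) : Sub b s ≤ N := by
  intro x hx
  rw [← b.linearCombination_repr x, Finsupp.linearCombination_apply]
  exact Submodule.sum_mem _ fun i hi => N.smul_mem _ (h i ((mem_sub b).1 hx hi))

end Sub

variable {I J L₁ L₂ : Type u} [AddCommGroup L₁] [Module A L₁] [AddCommGroup L₂] [Module A L₂]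
  (b₁ : Module.Basis I A L₁) (b₂ : Module.Basis J A L₂) (φ : L₁ →ₗ[A] L₂)

/-- Pairs of finite subsets compatible with `φ`. -/
def Idx : Type u := {p : Finset I × Finset J // Sub b₁ p.1 ≤ (Sub b₂ p.2).comap φ}

instance : PartialOrder (Idx b₁ b₂ φ) := inferInstanceAs (PartialOrder (Subtype _))

variable {b₁ b₂ φ}

/-- Source of the subpresentation. -/
noncomputable abbrev Src (p : Idx b₁ b₂ φ) : Submodule A L₁ := Sub b₁ p.1.1

/-- Target of the subpresentation. -/
noncomputable abbrev Tgt (p : Idx b₁ b₂ φ) : Submodule A L₂ := Sub b₂ p.1.2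

/-- Restriction of `φ`. -/
noncomputable def res (p : Idx b₁ b₂ φ) : Src p →ₗ[A] Tgt p := φ.restrict p.2

/-- The finitely presented quotient. -/
noncomputable abbrev Obj (p : Idx b₁ b₂ φ) : Type u := Tgt p ⧸ LinearMap.range (res p)

lemma src_mono {p q : Idx b₁ b₂ φ} (h : p ≤ q) : Src p ≤ Src q :=
  sub_mono _ h.1

lemma tgt_mono {p q : Idx b₁ b₂ φ} (h : p ≤ q) : Tgt p ≤ Tgt q :=
  sub_mono _ h.2

/-- Transition maps. -/
noncomputable def trans {p q : Idx b₁ b₂ φ} (h : p ≤ q) : Obj p →ₗ[A] Obj q :=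
  Submodule.mapQ _ _ (Submodule.inclusion (tgt_mono h)) (by
    rintro _ ⟨x, rfl⟩
    exact ⟨Submodule.inclusion (src_mono h) x, rfl⟩)

variable (b₁ b₂ φ) in
/-- The diagram. -/
noncomputable def diag : Idx b₁ b₂ φ ⥤ ModuleCat.{u} A where
  obj p := ModuleCat.of A (Obj p)
  map h := ModuleCat.ofHom (trans h.le)
  map_id p := by
    ext x
    rfl
  map_comp f g := by
    ext x
    rfl

variable (b₁ b₂ φ) in
lemma exists_idx (s : Finset I) (t : Finset J) :
    ∃ p : Idx b₁ b₂ φ, s ⊆ p.1.1 ∧ t ⊆ p.1.2 := by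
  classical
  refine ⟨⟨(s, t ∪ s.biUnion fun i => (b₂.repr (φ (b₁ i))).support), ?_⟩,
    subset_rfl, Finset.subset_union_left⟩
  refine sub_le b₁ fun i hi => ?_
  exact (mem_sub b₂).2 ((Finset.subset_biUnion_of_mem
    (fun i => (b₂.repr (φ (b₁ i))).support) hi).trans Finset.subset_union_right)

instance : Nonempty (Idx b₁ b₂ φ) := ⟨(exists_idx b₁ b₂ φ ∅ ∅).choose⟩

instance : IsDirectedOrder (Idx b₁ b₂ φ) where
  directed p q := by
    classical
    obtain ⟨r, h1, h2⟩ := exists_idx b₁ b₂ φ (p.1.1 ∪ q.1.1) (p.1.2 ∪ q.1.2)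
    exact ⟨r, ⟨Finset.subset_union_left.trans h1, Finset.subset_union_left.trans h2⟩,
      ⟨Finset.subset_union_right.trans h1, Finset.subset_union_right.trans h2⟩⟩

variable {X : Type u} [AddCommGroup X] [Module A X] (g : L₂ →ₗ[A] X)
  (hex : Function.Exact φ g)

/-- Map to `X`. -/
noncomputable def toX (p : Idx b₁ b₂ φ) : Obj p →ₗ[A] X :=
  Submodule.liftQ _ (g ∘ₗ (Tgt p).subtype) (by
    rintro _ ⟨x, rfl⟩
    exact hex.apply_apply_eq_zero x.1)

variable (b₁ b₂) in
/-- The cocone. -/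
noncomputable def cocone : Cocone (diag b₁ b₂ φ) where
  pt := ModuleCat.of A X
  ι :=
    { app := fun p => ModuleCat.ofHom (toX g hex p)
      naturality := by
        intro p q f
        ext x
        obtain ⟨y, rfl⟩ := Submodule.mkQ_surjective (LinearMap.range (res p)) x
        rfl }

variable (b₁ b₂) in
/-- The cocone is a colimit. -/
noncomputable def isColimitCocone (hg : Function.Surjective g) : IsColimit (cocone b₁ b₂ g hex) := by
  apply isColimitOfReflects (forget (ModuleCat.{u} A))
  apply Types.FilteredColimit.isColimitOf'
  · intro x
    obtain ⟨y, hy⟩ := hg x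
    obtain ⟨p, -, hp⟩ := exists_idx b₁ b₂ φ ∅ (b₂.repr y).support
    exact ⟨p, Submodule.Quotient.mk (⟨y, (mem_sub b₂).2 hp⟩ : Tgt p), hy.symm⟩
  · intro p x y hxy
    obtain ⟨x, rfl⟩ := Submodule.mkQ_surjective _ x
    obtain ⟨y, rfl⟩ := Submodule.mkQ_surjective _ y
    have hxy' : g x.1 = g y.1 := hxy
    have h0 : g (x.1 - y.1) = 0 := by rw [map_sub, hxy', sub_self]
    obtain ⟨c, hc⟩ := (hex _).1 h0
    classical
    obtain ⟨q, h1, h2⟩ := exists_idx b₁ b₂ φ (p.1.1 ∪ (b₁.repr c).support) p.1.2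
    have hpq : p ≤ q := ⟨Finset.subset_union_left.trans h1, h2⟩
    refine ⟨q, homOfLE hpq, ?_⟩
    refine (Submodule.Quotient.eq (LinearMap.range (res q))
      (x := Submodule.inclusion (tgt_mono hpq) x)
      (y := Submodule.inclusion (tgt_mono hpq) y)).2 ?_
    refine ⟨⟨c, (mem_sub b₁).2 (Finset.subset_union_right.trans h1)⟩, ?_⟩
    exact Subtype.ext hc

lemma res_injective (hφ : Function.Injective φ) (p : Idx b₁ b₂ φ) : Function.Injective (res p) :=
  fun _ _ h => Subtype.ext (hφ (congrArg Subtype.val h))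

lemma fp_obj (p : Idx b₁ b₂ φ) : Module.FinitePresentation A (Obj p) :=
  Module.finitePresentation_of_free_of_surjective (Submodule.mkQ _)
    (Submodule.mkQ_surjective _) (by
      rw [Submodule.ker_mkQ]
      exact (Module.Finite.iff_fg).1 inferInstance)

lemma shortExact_of {P Q X : Type u} [AddCommGroup P] [AddCommGroup Q] [AddCommGroup X]
    [Module A P] [Module A Q] [Module A X] (f : P →ₗ[A] Q) (g : Q →ₗ[A] X)
    (hf : Function.Injective f) (hex : Function.Exact f g) (hg : Function.Surjective g) :
    (ShortComplex.mk (ModuleCat.ofHom f) (ModuleCat.ofHom g)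
      (by ext x; exact hex.apply_apply_eq_zero x)).ShortExact :=
  ModuleCat.shortComplex_shortExact _ hex hf hg

/-- The theorem in the case of a free resolution with chosen bases. -/
theorem main_free (hex : Function.Exact φ g) (b₁ : Module.Basis I A L₁) (b₂ : Module.Basis J A L₂)
    [HasExt.{u} (ModuleCat.{u} A)] (𝒴 : Set (ModuleCat.{u} A))
    (hφ : Function.Injective φ) (hg : Function.Surjective g)
    (hX : ∀ Y ∈ 𝒴, Subsingleton (Abelian.Ext (ModuleCat.of A X) Y 1)) :
    ∃ (J : Type u) (_ : SmallCategory J) (_ : IsFiltered J) (F : J ⥤ ModuleCat.{u} A),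
      (∀ j : J, Module.FinitePresentation A (F.obj j) ∧
        (∃ (Pj Qj : ModuleCat.{u} A) (fj : Pj ⟶ Qj) (gj : Qj ⟶ F.obj j)
          (wj : fj ≫ gj = 0),
          (ShortComplex.mk fj gj wj).ShortExact ∧
          Projective Pj ∧ Module.Finite A Pj ∧ Projective Qj ∧ Module.Finite A Qj) ∧
        (∀ Y ∈ 𝒴, Subsingleton (Abelian.Ext (F.obj j) Y 1))) ∧
      Nonempty (ModuleCat.of A X ≅ colimit F) := by
  refine ⟨Idx b₁ b₂ φ, inferInstance, inferInstance, diag b₁ b₂ φ, fun p => ?_,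
    ⟨(isColimitCocone b₁ b₂ g hex hg).coconePointUniqueUpToIso (colimit.isColimit _)⟩⟩
  have hse := shortExact_of (res p) (LinearMap.range (res p)).mkQ (res_injective hφ p)
    (LinearMap.exact_map_mkQ_range _) (Submodule.mkQ_surjective _)
  have hQ : Projective (ModuleCat.of A (Tgt p)) := inferInstance
  refine ⟨fp_obj p, ⟨_, _, _, _, _, hse, inferInstance,
    inferInstanceAs (Module.Finite A (Src p)), hQ,
    inferInstanceAs (Module.Finite A (Tgt p))⟩, fun Y hY => ?_⟩
  refine subsingleton_ext hse Y fun h => ?_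
  classical
  have := hX Y hY
  obtain ⟨r, hr⟩ := exists_retraction b₁ p.1.1
  obtain ⟨k, hk⟩ := exists_extension (shortExact_of φ g hφ hex hg) Y
    (ModuleCat.ofHom (h.hom ∘ₗ r))
  refine ⟨ModuleCat.ofHom (k.hom ∘ₗ (Tgt p).subtype), ?_⟩
  ext x
  have h1 := LinearMap.congr_fun (congrArg ModuleCat.Hom.hom hk) x.1
  refine h1.trans ?_
  exact congrArg h.hom (hr x)

end Free

end FilteredColimitFP

open FilteredColimitFP in
/-- Let `A` be a ring, `𝒴` a class of `A`-modules and `X` a module of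
projective dimension at most 1 (witnessed by a short exact sequence `0 → P → Q → X → 0`
with `P`, `Q` projective) such that `Ext¹(X, Y) = 0` for all `Y ∈ 𝒴`. Then `X` is a
filtered colimit of finitely presented modules with the same two properties, where the
projective modules in the presentations are moreover finitely generated. -/
theorem filtered_colimit_of_fp_ext_orthogonal
    {A : Type u} [Ring A] [HasExt.{u} (ModuleCat.{u} A)]
    (𝒴 : Set (ModuleCat.{u} A))
    (P Q X : ModuleCat.{u} A) (f : P ⟶ Q) (g : Q ⟶ X) (w : f ≫ g = 0)
    (hse : (ShortComplex.mk f g w).ShortExact)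
    (hP : Projective P) (hQ : Projective Q)
    (hX : ∀ Y ∈ 𝒴, Subsingleton (Abelian.Ext X Y 1)) :
    ∃ (J : Type u) (_ : SmallCategory J) (_ : IsFiltered J) (F : J ⥤ ModuleCat.{u} A),
      (∀ j : J, Module.FinitePresentation A (F.obj j) ∧
        (∃ (Pj Qj : ModuleCat.{u} A) (fj : Pj ⟶ Qj) (gj : Qj ⟶ F.obj j)
          (wj : fj ≫ gj = 0),
          (ShortComplex.mk fj gj wj).ShortExact ∧
          Projective Pj ∧ Module.Finite A Pj ∧ Projective Qj ∧ Module.Finite A Qj) ∧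
        (∀ Y ∈ 𝒴, Subsingleton (Abelian.Ext (F.obj j) Y 1))) ∧
      Nonempty (X ≅ colimit F) := by
  have hf : Function.Injective f.hom := hse.moduleCat_injective_f
  have hg : Function.Surjective g.hom := hse.moduleCat_surjective_g
  have hex : Function.Exact f.hom g.hom :=
    (ShortComplex.ShortExact.moduleCat_exact_iff_function_exact _).1 hse.exact
  obtain ⟨F₁, _, _, hF₁, hPF⟩ := exists_free_compl (A := A) P
  obtain ⟨F₂, _, _, hF₂, hQF⟩ := exists_free_compl (A := A) Q
  have hP' : Module.Free A (P × (F₁ × F₂)) :=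
    Module.Free.of_equiv (LinearEquiv.prodAssoc A P F₁ F₂)
  have hQ' : Module.Free A (Q × (F₁ × F₂)) :=
    Module.Free.of_equiv ((LinearEquiv.prodAssoc A Q F₂ F₁).trans
      ((LinearEquiv.refl A Q).prodCongr (LinearEquiv.prodComm A F₂ F₁)))
  let f' : (P × (F₁ × F₂)) →ₗ[A] (Q × (F₁ × F₂)) := f.hom.prodMap LinearMap.id
  let g' : (Q × (F₁ × F₂)) →ₗ[A] X := g.hom ∘ₗ LinearMap.fst A _ _
  have hf' : Function.Injective f' := Function.Injective.prodMap hf Function.injective_id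
  have hg' : Function.Surjective g' := hg.comp Prod.fst_surjective
  have hex' : ∀ y, g' y = 0 ↔ ∃ x, f' x = y := by
    rintro ⟨y, z⟩
    refine (hex y).trans ⟨?_, ?_⟩
    · rintro ⟨x, rfl⟩
      exact ⟨(x, z), rfl⟩
    · rintro ⟨x, hx⟩
      exact ⟨x.1, congrArg Prod.fst hx⟩
  exact main_free (φ := f') g' hex' (Module.Free.chooseBasis A (P × (F₁ × F₂)))
    (Module.Free.chooseBasis A (Q × (F₁ × F₂))) 𝒴 hf' hg' hX
end

section
/- Let A be a hereditary ring and (𝒳, 𝒴) an Ext-orthogonal pair for Mod A. Let M be an A-module with Ext_A^1(M, Y) = 0 for all Y ∈ 𝒴, and suppose 0 → Y₁ → X₁ → M → Y₂ → X₂ → 0 is an exact sequence of A-modules with X₁, X₂ ∈ 𝒳 and Y₁, Y₂ ∈ 𝒴. Then Y₁ = 0; equivalently, the map X₁ → M is injective. -/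
open CategoryTheory CategoryTheory.Limits

universe u

open Abelian in
lemma hereditary_ext_two_aux {A : Type u} [Ring A] (hA : IsHereditaryRing A)
    (C : ModuleCat.{u} A) : HasProjectiveDimensionLT C 2 := by
  let P := Projective.over C
  let p : P ⟶ C := Projective.π C
  have hP : Module.Projective A P := ModuleCat.projective_of_module_projective P
  have hK : Module.Projective A (LinearMap.ker p.hom) := hA P hP _
  have hK' : Projective (kernel p) :=
    Projective.of_iso (ModuleCat.kernelIsoKer p).symm
      ((IsProjective.iff_projective _).1 hK)
  have hS : (ShortComplex.mk (kernel.ι p) p (kernel.condition p)).ShortExact :=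
    { exact := ShortComplex.exact_kernel p }
  exact (hS.hasProjectiveDimensionLT_X₃_iff 0 (inferInstanceAs (Projective P))).2
    (inferInstanceAs (HasProjectiveDimensionLT (kernel p) 1))

/-- Over a hereditary ring, if `(𝒳, 𝒴)` is an Ext-orthogonal pair, `M`
satisfies `Ext¹(M, Y) = 0` for all `Y ∈ 𝒴` and
`0 → Y₁ → X₁ → M → Y₂ → X₂ → 0` is a five-term exact sequence with `X₁, X₂ ∈ 𝒳` and
`Y₁, Y₂ ∈ 𝒴`, then `Y₁ = 0`; equivalently the map `X₁ → M` is injective (a monomorphism). -/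
theorem first_term_vanishes_of_ext_one_orthogonal
    {A : Type u} [Ring A] [HasExt.{u} (ModuleCat.{u} A)]
    (hA : IsHereditaryRing A)
    (𝒳 𝒴 : Set (ModuleCat.{u} A))
    (h𝒴 : 𝒴 = {Y | ∀ X ∈ 𝒳, ∀ n : ℕ, Subsingleton (Abelian.Ext X Y n)})
    (h𝒳 : 𝒳 = {X | ∀ Y ∈ 𝒴, ∀ n : ℕ, Subsingleton (Abelian.Ext X Y n)})
    {M Y₁ X₁ Y₂ X₂ : ModuleCat.{u} A}
    (hM : ∀ Y ∈ 𝒴, Subsingleton (Abelian.Ext M Y 1))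
    (f₁ : Y₁ ⟶ X₁) (f₂ : X₁ ⟶ M) (f₃ : M ⟶ Y₂) (f₄ : Y₂ ⟶ X₂)
    (hX₁ : X₁ ∈ 𝒳) (hX₂ : X₂ ∈ 𝒳) (hY₁ : Y₁ ∈ 𝒴) (hY₂ : Y₂ ∈ 𝒴)
    (hmono : Mono f₁) (hepi : Epi f₄)
    (w₁₂ : f₁ ≫ f₂ = 0) (w₂₃ : f₂ ≫ f₃ = 0) (w₃₄ : f₃ ≫ f₄ = 0)
    (ex₁ : (ShortComplex.mk f₁ f₂ w₁₂).Exact)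
    (ex₂ : (ShortComplex.mk f₂ f₃ w₂₃).Exact)
    (ex₃ : (ShortComplex.mk f₃ f₄ w₃₄).Exact) :
    IsZero Y₁ ∧ Mono f₂ := by
  have z : f₁ ≫ factorThruImage f₂ = 0 := by
    rw [← cancel_mono (image.ι f₂)]; simp [w₁₂]
  have hS : (ShortComplex.mk f₁ (factorThruImage f₂) z).ShortExact :=
    { exact := by
        let φ : ShortComplex.mk f₁ (factorThruImage f₂) z ⟶ ShortComplex.mk f₁ f₂ w₁₂ :=
          { τ₁ := 𝟙 _, τ₂ := 𝟙 _, τ₃ := image.ι f₂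
            comm₁₂ := (Category.id_comp _).trans (Category.comp_id _).symm
            comm₂₃ := (Category.id_comp _).trans (image.fac f₂).symm }
        have : Epi φ.τ₁ := inferInstanceAs (Epi (𝟙 _))
        have : IsIso φ.τ₂ := inferInstanceAs (IsIso (𝟙 _))
        have : Mono φ.τ₃ := inferInstanceAs (Mono (image.ι f₂))
        exact (ShortComplex.exact_iff_of_epi_of_isIso_of_mono φ).2 ex₁
      mono_f := hmono
      epi_g := inferInstanceAs (Epi (factorThruImage f₂)) }
  have hT : (ShortComplex.mk (image.ι f₂) (cokernel.π (image.ι f₂))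
      (cokernel.condition _)).ShortExact :=
    { exact := ShortComplex.exact_cokernel _ }
  -- the extension class of `Y₁ → X₁ → im f₂` lifts to `M`, hence vanishes
  have hclass : hS.extClass = 0 := by
    obtain ⟨x, hx⟩ := Abelian.Ext.contravariant_sequence_exact₁ hT Y₁ hS.extClass
      (n₁ := 2) rfl
      (by
        have := hereditary_ext_two_aux hA (cokernel (image.ι f₂))
        exact Abelian.Ext.eq_zero_of_hasProjectiveDimensionLT _ 2 le_rfl)
    have h0 : x = 0 := (hM Y₁ hY₁).elim _ _
    rw [← hx, h0, Abelian.Ext.comp_zero]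
  obtain ⟨x, hx⟩ := Abelian.Ext.contravariant_sequence_exact₁ hS Y₁
    (Abelian.Ext.mk₀ (𝟙 Y₁)) (n₁ := 1) rfl (by rw [hclass, Abelian.Ext.zero_comp])
  have hXY : Subsingleton (Abelian.Ext X₁ Y₁ 0) := by
    rw [h𝒴] at hY₁
    exact hY₁ X₁ hX₁ 0
  have h0 : x = 0 := hXY.elim _ _
  have hid : 𝟙 Y₁ = 0 := by
    apply Abelian.Ext.homEquiv₀.symm.injective
    simp only [Abelian.Ext.homEquiv₀_symm_apply, Abelian.Ext.mk₀_zero]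
    rw [← hx, h0, Abelian.Ext.comp_zero]
  have hZ : IsZero Y₁ := (IsZero.iff_id_eq_zero _).2 hid
  exact ⟨hZ, ex₁.mono_g (hZ.eq_of_src _ _)⟩
end

section
/- Let A be a hereditary ring, M a finitely presented A-module, and N a submodule of M. Then N is isomorphic to a direct sum ⨁_{i ∈ ι} N_i of finitely presented A-modules N_i (over some index set ι). -/
open CategoryTheory

universe u

namespace HeredAux

section lattice

theorem sSupIndep_union {α : Type*} [CompleteLattice α] [IsModularLattice α] {S T : Set α}
    (hS : sSupIndep S) (hT : sSupIndep T) (h : Disjoint (sSup S) (sSup T)) :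
    sSupIndep (S ∪ T) := by
  have key : ∀ {S T : Set α}, sSupIndep S → Disjoint (sSup S) (sSup T) →
      ∀ a ∈ S, Disjoint a (sSup ((S ∪ T) \ {a})) := by
    intro S T hS h a ha
    have h1 : Disjoint a (sSup (S \ {a}) ⊔ sSup T) := by
      apply Disjoint.disjoint_sup_right_of_disjoint_sup_left (hS ha)
      refine h.mono_left (sup_le (le_sSup ha) (sSup_le_sSup Set.sdiff_subset))
    refine h1.mono_right (sSup_le ?_)
    rintro b ⟨hb | hb, hba⟩
    · exact le_sup_of_le_left (le_sSup ⟨hb, hba⟩)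
    · exact le_sup_of_le_right (le_sSup hb)
  rintro a (ha | ha)
  · exact key hS h a ha
  · rw [Set.union_comm]
    exact key hT h.symm a ha

end lattice

variable {A : Type u} [Ring A]

theorem map_sSup_eq {P Q : Type u} [AddCommGroup P] [Module A P] [AddCommGroup Q] [Module A Q]
    (f : P →ₗ[A] Q) (S : Set (Submodule A P)) :
    sSup (Submodule.map f '' S) = Submodule.map f (sSup S) := by
  rw [sSup_image, (Submodule.gc_map_comap f).l_sSup]

theorem sSupIndep_map {P Q : Type u} [AddCommGroup P] [Module A P] [AddCommGroup Q] [Module A Q]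
    (f : P →ₗ[A] Q) (hf : Function.Injective f) {S : Set (Submodule A P)} (hS : sSupIndep S) :
    sSupIndep (Submodule.map f '' S) := by
  rintro _ ⟨a, ha, rfl⟩
  have h1 : Disjoint (Submodule.map f a) (Submodule.map f (sSup (S \ {a}))) := by
    rw [disjoint_iff, ← Submodule.map_inf f hf, disjoint_iff.1 (hS ha), Submodule.map_bot]
  refine h1.mono_right (sSup_le ?_)
  rintro _ ⟨⟨b, hb, rfl⟩, hne⟩
  apply Submodule.map_mono
  refine le_sSup ⟨hb, ?_⟩
  rintro rfl
  exact hne rfl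

theorem ker_split {P F : Type u} [AddCommGroup P] [Module A P] [AddCommGroup F] [Module A F]
    (f : P →ₗ[A] F) (h : Module.Projective A (LinearMap.range f)) :
    (∃ C, IsCompl (LinearMap.ker f) C) ∧ (Module.Finite A P → (LinearMap.ker f).FG) := by
  obtain ⟨g, hg⟩ := Module.projective_lifting_property f.rangeRestrict LinearMap.id
    f.surjective_rangeRestrict
  have hg' : ∀ y, f.rangeRestrict (g y) = y := fun y => LinearMap.congr_fun hg y
  have hfg : ∀ x, f (g (f.rangeRestrict x)) = f x := fun x =>
    congrArg Subtype.val (hg' (f.rangeRestrict x))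
  let r : P →ₗ[A] LinearMap.ker f :=
    LinearMap.codRestrict _ (LinearMap.id - g ∘ₗ f.rangeRestrict) (fun x => by
      rw [LinearMap.mem_ker]
      simp only [LinearMap.sub_apply, LinearMap.id_apply, LinearMap.comp_apply, map_sub]
      rw [hfg, sub_self])
  have hr : ∀ x : LinearMap.ker f, r x = x := by
    rintro ⟨x, hx⟩
    apply Subtype.ext
    have : f.rangeRestrict x = 0 := Subtype.ext hx
    simp [r, this]
  refine ⟨⟨_, LinearMap.isCompl_of_proj hr⟩, fun hP => ?_⟩
  rw [← Module.Finite.iff_fg]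
  exact Module.Finite.of_surjective r (fun x => ⟨x, hr x⟩)

theorem exists_fg_summand (hA : IsHereditaryRing A) {P : Type u} [AddCommGroup P] [Module A P]
    (hP : Module.Projective A P) (X : Submodule A P) (hX : X.FG) :
    ∃ Q : Submodule A P, X ≤ Q ∧ Q.FG ∧ ∃ C, IsCompl Q C := by
  classical
  obtain ⟨s, hs⟩ := Module.projective_def'.1 hP
  have hs' : ∀ x, Finsupp.linearCombination A id (s x) = x := fun x => LinearMap.congr_fun hs x
  obtain ⟨t, rfl⟩ := hX
  let T : Finset P := t.biUnion fun x => (s x).support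
  have hF : Module.Projective A (P →₀ A) := inferInstance
  let f : P →ₗ[A] (P →₀ A) := (Finsupp.supported A A ((T : Set P)ᶜ)).subtype ∘ₗ
    Finsupp.restrictDom A A ((T : Set P)ᶜ) ∘ₗ s
  let π : (P →₀ A) →ₗ[A] P := Finsupp.linearCombination A id
  have hker : LinearMap.ker f = Submodule.comap s (Finsupp.supported A A (T : Set P)) := by
    ext x
    rw [LinearMap.mem_ker, Submodule.mem_comap, Finsupp.mem_supported']
    change Finsupp.filter (· ∈ ((T : Set P)ᶜ)) (s x) = 0 ↔ _
    rw [Finsupp.filter_eq_zero_iff]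
    rfl
  refine ⟨LinearMap.ker f, ?_, ?_, ?_⟩
  · rw [hker, Submodule.span_le]
    intro x hx
    change s x ∈ Finsupp.supported A A (T : Set P)
    rw [Finsupp.mem_supported]
    intro p hp
    exact Finset.mem_coe.2 (Finset.mem_biUnion.2 ⟨x, hx, hp⟩)
  · let h : Finsupp.supported A A (T : Set P) →ₗ[A] (P →₀ A) :=
      (LinearMap.id - s ∘ₗ π) ∘ₗ (Finsupp.supported A A (T : Set P)).subtype
    have hfin : Module.Finite A (Finsupp.supported A A (T : Set P)) :=
      Module.Finite.equiv (Finsupp.supportedEquivFinsupp (M := A) (R := A) (T : Set P)).symm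
    have hh := (ker_split (P := Finsupp.supported A A (T : Set P)) h (hA _ hF _)).2 hfin
    have : LinearMap.ker f =
        (LinearMap.ker h).map (π ∘ₗ (Finsupp.supported A A (T : Set P)).subtype) := by
      rw [hker]
      ext x
      constructor
      · intro hx
        refine ⟨⟨s x, hx⟩, ?_, hs' x⟩
        change s x - s (π (s x)) = 0
        rw [hs' x, sub_self]
      · rintro ⟨⟨v, hv⟩, hvk, rfl⟩
        have h1 : v - s (π v) = 0 := hvk
        change s (π v) ∈ Finsupp.supported A A (T : Set P)
        rwa [← sub_eq_zero.1 h1]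
    rw [this]
    exact hh.map _
  · exact (ker_split f (hA _ hF _)).1

theorem fg_right {P : Type u} [AddCommGroup P] [Module A P] {Q N : Submodule A P}
    (h : Disjoint Q N) (hf : (Q ⊔ N).FG) : N.FG := by
  apply Submodule.fg_of_fg_map_of_fg_inf_ker Q.mkQ
  · have := hf.map Q.mkQ
    rwa [Submodule.map_sup, Submodule.mkQ_map_self, bot_sup_eq] at this
  · rw [Submodule.ker_mkQ, inf_comm, disjoint_iff.1 h]
    exact Submodule.fg_bot

theorem countable_case (hA : IsHereditaryRing A) {P : Type u} [AddCommGroup P] [Module A P]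
    (hP : Module.Projective A P) (x : ℕ → P) (hx : Submodule.span A (Set.range x) = ⊤) :
    ∃ S : Set (Submodule A P), sSupIndep S ∧ sSup S = ⊤ ∧ ∀ a ∈ S, a.FG := by
  let good : Set (Submodule A P) → Prop := fun S =>
    sSupIndep S ∧ (∀ a ∈ S, a.FG) ∧ (sSup S).FG ∧ ∃ C, IsCompl (sSup S) C
  have step : ∀ (y : P) (S : {S // good S}), ∃ S' : {S // good S}, S.1 ⊆ S'.1 ∧ y ∈ sSup S'.1 := by
    rintro y ⟨S, hS, hfg, hsup, C, hC⟩
    obtain ⟨Q, hQ, hQfg, hQC⟩ := exists_fg_summand hA hP (sSup S ⊔ Submodule.span A {y})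
      (hsup.sup (Submodule.fg_span_singleton y))
    have hSQ : sSup S ≤ Q := le_sup_left.trans hQ
    have e : sSup S ⊔ (C ⊓ Q) = Q := by
      rw [← sup_inf_assoc_of_le _ hSQ, hC.sup_eq_top, top_inf_eq]
    have hd : Disjoint (sSup S) (C ⊓ Q) := hC.disjoint.mono_right inf_le_left
    have e' : sSup (S ∪ {C ⊓ Q}) = Q := by rw [sSup_union, sSup_singleton, e]
    refine ⟨⟨S ∪ {C ⊓ Q}, ?_, ?_, ?_, ?_⟩, Set.subset_union_left, ?_⟩
    · exact sSupIndep_union hS (sSupIndep_singleton _) (by rwa [sSup_singleton])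
    · rintro a (ha | rfl)
      · exact hfg a ha
      · exact fg_right hd (by rwa [e])
    · rwa [e']
    · rwa [e']
    · change y ∈ sSup (S ∪ {C ⊓ Q})
      rw [e']
      exact hQ (Submodule.mem_sup_right (Submodule.mem_span_singleton_self y))
  choose next h1 h2 using step
  have good0 : good ∅ := by
    refine ⟨sSupIndep_empty, by simp, ?_, ?_⟩
    · rw [sSup_empty]; exact Submodule.fg_bot
    · rw [sSup_empty]; exact ⟨⊤, isCompl_bot_top⟩
  let seq : ℕ → {S // good S} := fun n => Nat.rec ⟨∅, good0⟩ (fun n S => next (x n) S) n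
  have hmono : Monotone fun n => (seq n).1 := monotone_nat_of_le_succ fun n => h1 (x n) (seq n)
  refine ⟨⋃ n, (seq n).1, ?_, ?_, ?_⟩
  · exact sSupIndep_iUnion_of_directed hmono.directed_le fun n => (seq n).2.1
  · rw [eq_top_iff, ← hx, Submodule.span_le]
    rintro _ ⟨n, rfl⟩
    have : sSup (seq (n+1)).1 ≤ sSup (⋃ n, (seq n).1) :=
      sSup_le_sSup (Set.subset_iUnion (fun n => (seq n).1) (n+1))
    exact this (h2 (x n) (seq n))
  · intro a ha
    obtain ⟨n, hn⟩ := Set.mem_iUnion.1 ha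
    exact (seq n).2.2.1 a hn

theorem projective_decomp (hA : IsHereditaryRing A) {P : Type u} [AddCommGroup P] [Module A P]
    (hP : Module.Projective A P) :
    ∃ S : Set (Submodule A P), sSupIndep S ∧ sSup S = ⊤ ∧ ∀ a ∈ S, a.FG := by
  classical
  obtain ⟨s, hs⟩ := Module.projective_def'.1 hP
  have hs' : ∀ x, Finsupp.linearCombination A id (s x) = x := fun x => LinearMap.congr_fun hs x
  let closed : Set P → Prop := fun J => ∀ x ∈ J, ∀ p ∈ (s x).support, p ∈ J
  let Z : Set (Set P × Set (Submodule A P)) := {z | closed z.1 ∧ sSupIndep z.2 ∧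
    sSup z.2 = Submodule.span A z.1 ∧ ∀ a ∈ z.2, a.FG}
  obtain ⟨⟨J, S⟩, hm⟩ := zorn_le₀ Z (by
    intro c hc hchain
    refine ⟨sSup c, ⟨?_, ?_, ?_, ?_⟩, fun z hz => le_sSup hz⟩
    · rintro x ⟨_, ⟨z, hz, rfl⟩, hxz⟩ p hp
      exact ⟨_, ⟨z, hz, rfl⟩, (hc hz).1 x hxz p hp⟩
    · refine iSupIndep_sUnion_of_directed ?_ ?_
      · rintro _ ⟨z, hz, rfl⟩ _ ⟨w, hw, rfl⟩
        rcases hchain.total hz hw with h | h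
        · exact ⟨_, ⟨w, hw, rfl⟩, h.2, le_rfl⟩
        · exact ⟨_, ⟨z, hz, rfl⟩, le_rfl, h.2⟩
      · rintro _ ⟨z, hz, rfl⟩
        exact (hc hz).2.1
    · apply le_antisymm
      · refine sSup_le ?_
        rintro a ⟨_, ⟨z, hz, rfl⟩, ha⟩
        refine (le_sSup ha).trans ?_
        rw [(hc hz).2.2.1]
        exact Submodule.span_mono (Set.subset_sUnion_of_mem ⟨z, hz, rfl⟩)
      · rw [Submodule.span_le]
        rintro x ⟨_, ⟨z, hz, rfl⟩, hx⟩
        have h1 : x ∈ sSup z.2 := by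
          rw [(hc hz).2.2.1]; exact Submodule.subset_span hx
        have h2 : sSup z.2 ≤ sSup (sSup c).2 :=
          sSup_le_sSup (Set.subset_sUnion_of_mem ⟨z, hz, rfl⟩)
        exact h2 h1
    · rintro a ⟨_, ⟨z, hz, rfl⟩, ha⟩
      exact (hc hz).2.2.2 a ha)
  obtain ⟨hcl, hind, hsup, hfg⟩ := hm.prop
  dsimp only at hcl hind hsup hfg
  suffices hJ : ∀ x, x ∈ J by
    refine ⟨S, hind, ?_, hfg⟩
    rw [hsup, Set.eq_univ_of_forall hJ, Submodule.span_univ]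
  intro x
  -- countable closure
  let D : ℕ → Set P := fun n => Nat.rec {x} (fun _ D => ⋃ p ∈ D, ((s p).support : Set P)) n
  have hDs : ∀ n, D (n+1) = ⋃ p ∈ D n, ((s p).support : Set P) := fun n => rfl
  have hDc : ∀ n, (D n).Countable := by
    intro n
    induction n with
    | zero => exact Set.countable_singleton x
    | succ n ih =>
      rw [hDs]
      exact ih.biUnion fun p _ => (Finset.countable_toSet _)
  let C : Set P := ⋃ n, D n
  have hCc : C.Countable := Set.countable_iUnion hDc
  have hxC : x ∈ C := Set.mem_iUnion.2 ⟨0, rfl⟩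
  have hCcl : closed C := by
    intro y hy p hp
    obtain ⟨n, hn⟩ := Set.mem_iUnion.1 hy
    refine Set.mem_iUnion.2 ⟨n+1, ?_⟩
    rw [hDs]
    exact Set.mem_biUnion hn hp
  obtain ⟨c, hc⟩ := hCc.exists_eq_range ⟨x, hxC⟩
  -- the projection onto span J
  let r : P →ₗ[A] P := Finsupp.linearCombination A id ∘ₗ
    (Finsupp.supported A A J).subtype ∘ₗ Finsupp.restrictDom A A J ∘ₗ s
  have hrmem : ∀ y, r y ∈ Submodule.span A J := by
    intro y
    rw [← Set.image_id J, Finsupp.mem_span_image_iff_linearCombination]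
    exact ⟨_, (Finsupp.restrictDom A A J (s y)).2, rfl⟩
  have hrid : ∀ y ∈ Submodule.span A J, r y = y := by
    intro y hy
    induction hy using Submodule.span_induction with
    | mem y hy =>
      change Finsupp.linearCombination A id (Finsupp.filter (· ∈ J) (s y)) = y
      rw [(Finsupp.filter_eq_self_iff _ _).2, hs']
      intro p hp
      exact hcl y hy p (Finsupp.mem_support_iff.2 hp)
    | zero => simp
    | add y z _ _ hy hz => rw [map_add, hy, hz]
    | smul a y _ hy => rw [map_smul, hy]
  let y : ℕ → P := fun n => c n - r (c n)
  let E : Submodule A P := Submodule.span A (Set.range y)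
  have hEker : E ≤ LinearMap.ker r := by
    rw [Submodule.span_le]
    rintro _ ⟨n, rfl⟩
    change r (c n - r (c n)) = 0
    rw [map_sub, hrid _ (hrmem _), sub_self]
  have hdisj : Disjoint (Submodule.span A J) E := by
    rw [Submodule.disjoint_def]
    intro z hz hzE
    rw [← hrid z hz]
    exact hEker hzE
  have hsupE : Submodule.span A J ⊔ E = Submodule.span A (J ∪ C) := by
    rw [Submodule.span_union]
    apply le_antisymm
    · refine sup_le le_sup_left ?_
      rw [Submodule.span_le]
      rintro _ ⟨n, rfl⟩
      exact sub_mem (Submodule.mem_sup_right (Submodule.subset_span (hc ▸ ⟨n, rfl⟩)))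
        (Submodule.mem_sup_left (hrmem _))
    · refine sup_le le_sup_left ?_
      rw [Submodule.span_le, hc]
      rintro _ ⟨n, rfl⟩
      have : c n = r (c n) + y n := by simp [y]
      rw [this]
      exact add_mem (Submodule.mem_sup_left (hrmem _))
        (Submodule.mem_sup_right (Submodule.subset_span ⟨n, rfl⟩))
  obtain ⟨S', hS'ind, hS'sup, hS'fg⟩ := countable_case hA (hA P hP E)
    (fun n => ⟨y n, Submodule.subset_span ⟨n, rfl⟩⟩) (by
      apply Submodule.map_injective_of_injective E.injective_subtype
      rw [Submodule.map_span, ← Set.range_comp, Submodule.map_top, Submodule.range_subtype]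
      rfl)
  have hS2sup : sSup (Submodule.map E.subtype '' S') = E := by
    rw [map_sSup_eq, hS'sup, Submodule.map_top, Submodule.range_subtype]
  have hnew : (J ∪ C, S ∪ (Submodule.map E.subtype '' S')) ∈ Z := by
    refine ⟨?_, ?_, ?_, ?_⟩
    · rintro y (hy | hy) p hp
      · exact Or.inl (hcl y hy p hp)
      · exact Or.inr (hCcl y hy p hp)
    · refine sSupIndep_union hind (sSupIndep_map _ E.injective_subtype hS'ind) ?_
      rwa [hS2sup, hsup]
    · change sSup (S ∪ _) = Submodule.span A (J ∪ C)
      rw [sSup_union, hS2sup, hsup, hsupE]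
    · rintro a (ha | ⟨a, ha, rfl⟩)
      · exact hfg a ha
      · exact (hS'fg a ha).map _
  have hle := hm.le_of_ge hnew ⟨Set.subset_union_left, Set.subset_union_left⟩
  exact hle.1 (Or.inr hxC)

theorem exists_fg_summand_type (hA : IsHereditaryRing A) {P : Type u} [AddCommGroup P]
    [Module A P] (hP : Module.Projective A P) (X : Submodule A P) (hX : X.FG) :
    ∃ Q : Submodule A P, X ≤ Q ∧ Q.FG ∧ ∃ (C : Type u) (_ : AddCommGroup C) (_ : Module A C)
      (i : C →ₗ[A] P), Function.Injective i ∧ IsCompl Q (LinearMap.range i) ∧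
        Module.Projective A C := by
  obtain ⟨Q, h1, h2, C, hC⟩ := exists_fg_summand hA hP X hX
  exact ⟨Q, h1, h2, C, inferInstance, inferInstance, C.subtype, C.injective_subtype,
    by rwa [Submodule.range_subtype], hA _ hP C⟩

theorem quotient_decomp (hA : IsHereditaryRing A) {P N : Type u} [AddCommGroup P] [Module A P]
    [AddCommGroup N] [Module A N] (hP : Module.Projective A P) (f : P →ₗ[A] N)
    (hf : Function.Surjective f) (hker : (LinearMap.ker f).FG) :
    ∃ S : Set (Submodule A N), sSupIndep S ∧ sSup S = ⊤ ∧
      ∀ a ∈ S, Module.FinitePresentation A a := by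
  obtain ⟨Q, hkQ, hQfg, C, _, _, i, hi, hQC, hC⟩ := exists_fg_summand_type hA hP _ hker
  obtain ⟨S, hind, hsup, hfg⟩ := projective_decomp hA hC
  let g : C →ₗ[A] N := f ∘ₗ i
  have hg : Function.Injective g := by
    rw [← LinearMap.ker_eq_bot, LinearMap.ker_eq_bot']
    intro z hz
    have h1 : i z ∈ Q := hkQ hz
    apply hi
    rw [map_zero]
    exact (Submodule.disjoint_def.1 hQC.disjoint) _ h1 ⟨z, rfl⟩
  let S' : Set (Submodule A N) := {Submodule.map f Q} ∪ (Submodule.map g '' S)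
  have hgsup : sSup (Submodule.map g '' S) = Submodule.map f (LinearMap.range i) := by
    rw [map_sSup_eq, hsup, Submodule.map_comp, Submodule.map_top]
  have hS'ind : sSupIndep S' := by
    refine sSupIndep_union (sSupIndep_singleton _) (sSupIndep_map g hg hind) ?_
    rw [sSup_singleton, hgsup, Submodule.disjoint_def]
    rintro _ ⟨a, ha, rfl⟩ ⟨b, hb, hab⟩
    have h1 : b - a ∈ Q := hkQ (by rw [LinearMap.mem_ker, map_sub, hab, sub_self])
    have h2 : b ∈ Q := by simpa using Q.add_mem h1 ha
    have h3 : b = 0 := Submodule.disjoint_def.1 hQC.disjoint b h2 hb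
    rw [← hab, h3, map_zero]
  have hS'sup : sSup S' = ⊤ := by
    change sSup (_ ∪ _) = _
    rw [sSup_union, sSup_singleton, hgsup, ← Submodule.map_sup, hQC.sup_eq_top,
      Submodule.map_top, LinearMap.range_eq_top.2 hf]
  refine ⟨S', hS'ind, hS'sup, ?_⟩
  rintro _ (rfl | ⟨a, ha, rfl⟩)
  · have : Module.Projective A Q := hA _ hP Q
    have : Module.Finite A Q := Module.Finite.iff_fg.2 hQfg
    have := Module.finitePresentation_of_projective A Q
    refine Module.finitePresentation_of_surjective (f.submoduleMap Q)
      (f.submoduleMap_surjective Q) ?_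
    apply Submodule.fg_of_fg_map_injective Q.subtype Q.injective_subtype
    have : Submodule.map Q.subtype (LinearMap.ker (f.submoduleMap Q)) = LinearMap.ker f := by
      ext x
      constructor
      · rintro ⟨z, hz, rfl⟩
        exact congrArg Subtype.val hz
      · intro hx
        exact ⟨⟨x, hkQ hx⟩, Subtype.ext hx, rfl⟩
    rwa [this]
  · have : Module.Projective A a := hA _ hC a
    have : Module.Finite A a := Module.Finite.iff_fg.2 (hfg a ha)
    have := Module.finitePresentation_of_projective A a
    exact Module.FinitePresentation.of_equiv (Submodule.equivMapOfInjective g hg a)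

end HeredAux

/-- Over a hereditary ring, every submodule of a finitely presented module
is isomorphic to a direct sum of finitely presented modules. -/
theorem submodule_of_finitely_presented_is_direct_sum_of_finitely_presented
    {A : Type u} [Ring A] (hA : IsHereditaryRing A)
    (M : Type u) [AddCommGroup M] [Module A M] (hM : Module.FinitePresentation A M)
    (N : Submodule A M) :
    ∃ (ι : Type u) (Ni : ι → ModuleCat.{u} A),
      (∀ i, Module.FinitePresentation A (Ni i)) ∧
      Nonempty (N ≃ₗ[A] (DirectSum ι (fun i => Ni i))) := by
  classical
  obtain ⟨n, K, e, hK⟩ := Module.FinitePresentation.exists_fin A M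
  let q : (Fin n → A) →ₗ[A] M := e.symm.toLinearMap ∘ₗ K.mkQ
  have hq : Function.Surjective q := e.symm.surjective.comp K.mkQ_surjective
  have hqk : LinearMap.ker q = K := by
    rw [LinearEquiv.ker_comp, Submodule.ker_mkQ]
  let P : Submodule A (Fin n → A) := N.comap q
  have hP : Module.Projective A P := hA _ inferInstance P
  let f : P →ₗ[A] N := q.restrict (fun x hx => hx)
  have hf : Function.Surjective f := by
    rintro ⟨y, hy⟩
    obtain ⟨x, rfl⟩ := hq y
    exact ⟨⟨x, hy⟩, rfl⟩
  have hker : (LinearMap.ker f).FG := by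
    apply Submodule.fg_of_fg_map_injective P.subtype P.injective_subtype
    have : Submodule.map P.subtype (LinearMap.ker f) = K := by
      rw [← hqk]
      ext x
      constructor
      · rintro ⟨z, hz, rfl⟩
        exact congrArg Subtype.val hz
      · intro hx
        have hxP : x ∈ P := by
          change q x ∈ N
          rw [LinearMap.mem_ker.1 hx]; exact N.zero_mem
        exact ⟨⟨x, hxP⟩, Subtype.ext hx, rfl⟩
    rwa [this]
  obtain ⟨S', hS'ind, hS'sup, hfp⟩ := HeredAux.quotient_decomp (P := P) (N := N) hA hP f hf hker
  have hint : DirectSum.IsInternal (fun i : S' => (i : Submodule A N)) := by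
    apply DirectSum.isInternal_submodule_of_iSupIndep_of_iSup_eq_top
    · exact (sSupIndep_iff S').1 hS'ind
    · rw [← sSup_eq_iSup', hS'sup]
  refine ⟨S', fun i => ModuleCat.of A (i : Submodule A N), fun i => hfp i i.2, ?_⟩
  exact ⟨(LinearEquiv.ofBijective (DirectSum.coeLinearMap fun i : S' => (i : Submodule A N))
      hint).symm⟩
end
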